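/- Let d ≥ 2, p ≥ d and R₀ > 0, and let u be a positive C¹ weak solution of -Δ_p w = 0 in the exterior domain { x ∈ ℝ^d : ‖x‖ > R₀ }. Then exactly one of the following holds: (a) there is a constant c ∈ (0, ∞) with lim_{‖x‖ → ∞} u(x) = c; or (b) there is a constant c ∈ (0, ∞) such that, if p > d, lim_{‖x‖ → ∞} u(x)/‖x‖^{(p-d)/(p-1)} = c, and if p = d, lim_{‖x‖ → ∞} u(x)/log ‖x‖ = c. -/

import Mathlib

open MeasureTheory Metric Filter Topology Set
open scoped RealInnerProductSpace

noncomputable section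

/-- `u` is a positive `C¹` weak solution of `-Δ_p u + V|u|^{p-2}u = 0` in the open set `Ω`. -/
def IsPosWeakSol {d : ℕ} (p : ℝ) (V : EuclideanSpace ℝ (Fin d) → ℝ)
    (Ω : Set (EuclideanSpace ℝ (Fin d))) (u : EuclideanSpace ℝ (Fin d) → ℝ) : Prop :=
  ContDiffOn ℝ 1 u Ω ∧ (∀ x ∈ Ω, 0 < u x) ∧
  ∀ φ : EuclideanSpace ℝ (Fin d) → ℝ, ContDiff ℝ (⊤ : ℕ∞) φ → HasCompactSupport φ →
    tsupport φ ⊆ Ω →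
    ∫ x in Ω, (‖gradient u x‖ ^ (p - 2) * ⟪gradient u x, gradient φ x⟫ +
      V x * |u x| ^ (p - 2) * u x * φ x) = 0

section PositivePHarmonic

variable {d : ℕ}

local notation "𝔼" => EuclideanSpace ℝ (Fin d)

/-- The nonlinear flux `|v|^{p-2} v` of the `p`-Laplacian. -/
def pFlux {d : ℕ} (p : ℝ) (v : EuclideanSpace ℝ (Fin d)) : EuclideanSpace ℝ (Fin d) :=
  ‖v‖ ^ (p - 2) • v

/-- `u` is a `C¹` weak solution of `-Δ_p u = 0` in `Ω`, tested against `C¹` functions. -/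
def IsPHarmonic {d : ℕ} (p : ℝ) (Ω : Set (EuclideanSpace ℝ (Fin d)))
    (u : EuclideanSpace ℝ (Fin d) → ℝ) : Prop :=
  ContDiffOn ℝ 1 u Ω ∧
  ∀ φ : EuclideanSpace ℝ (Fin d) → ℝ, ContDiff ℝ 1 φ → HasCompactSupport φ →
    tsupport φ ⊆ Ω → ∫ x, fderiv ℝ φ x (pFlux p (gradient u x)) = 0



lemma continuous_pFlux {p : ℝ} (hp : 2 ≤ p) : Continuous (pFlux p : 𝔼 → 𝔼) := by
  unfold pFlux
  exact (continuous_norm.rpow_const (fun x => Or.inr (by linarith))).smul continuous_id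

lemma continuousOn_gradient {Ω : Set 𝔼} (hΩ : IsOpen Ω) {u : 𝔼 → ℝ} (hu : ContDiffOn ℝ 1 u Ω) :
    ContinuousOn (gradient u) Ω := by
  unfold gradient
  exact (InnerProductSpace.toDual ℝ 𝔼).symm.continuous.comp_continuousOn
    (hu.continuousOn_fderiv_of_isOpen hΩ le_rfl)

lemma continuous_of_continuousOn_of_zero {Y : Type*} [TopologicalSpace Y] [Zero Y]
    {Ω K : Set 𝔼} (hΩ : IsOpen Ω) (hK : IsClosed K)
    (hKΩ : K ⊆ Ω) {f : 𝔼 → Y} (hf : ContinuousOn f Ω) (h0 : ∀ x ∉ K, f x = 0) :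
    Continuous f := by
  rw [continuous_iff_continuousAt]
  intro x
  by_cases hx : x ∈ Ω
  · exact hf.continuousAt (hΩ.mem_nhds hx)
  · have : f =ᶠ[𝓝 x] fun _ => 0 := by
      filter_upwards [hK.isOpen_compl.mem_nhds (fun h => hx (hKΩ h))] with y hy
      exact h0 y hy
    exact (continuousAt_const).congr this.symm

lemma continuous_fderiv_pFlux {p : ℝ} (hp : 2 ≤ p) {Ω : Set 𝔼} (hΩ : IsOpen Ω) {u φ : 𝔼 → ℝ}
    (hu : ContDiffOn ℝ 1 u Ω) (hφ : ContDiff ℝ 1 φ) (hs : tsupport φ ⊆ Ω) :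
    Continuous fun x => fderiv ℝ φ x (pFlux p (gradient u x)) := by
  refine continuous_of_continuousOn_of_zero hΩ (isClosed_tsupport φ) hs ?_ ?_
  · exact (hφ.continuous_fderiv one_ne_zero).continuousOn.clm_apply
      ((continuous_pFlux hp).comp_continuousOn (continuousOn_gradient hΩ hu))
  · intro x hx
    have : x ∉ tsupport (fderiv ℝ φ) := fun h => hx (tsupport_fderiv_subset ℝ h)
    rw [image_eq_zero_of_notMem_tsupport this]; rfl

lemma exists_smooth_approx {φ : 𝔼 → ℝ} (hφ : ContDiff ℝ 1 φ) (hc : HasCompactSupport φ)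
    {δ ε : ℝ} (hδ : 0 < δ) (hε : 0 < ε) :
    ∃ ψ : 𝔼 → ℝ, ContDiff ℝ (⊤ : ℕ∞) ψ ∧ tsupport ψ ⊆ cthickening δ (tsupport φ) ∧
      ∀ x, ‖fderiv ℝ ψ x - fderiv ℝ φ x‖ ≤ ε := by
  have hcf : Continuous (fderiv ℝ φ) := hφ.continuous_fderiv one_ne_zero
  have huc : UniformContinuous (fderiv ℝ φ) :=
    (hc.fderiv ℝ).uniformContinuous_of_continuous hcf
  obtain ⟨η, hη, hηε⟩ := Metric.uniformContinuous_iff.1 huc ε hε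
  set r := min δ η with hr
  have hr0 : 0 < r := lt_min hδ hη
  let ρ : ContDiffBump (0 : 𝔼) := ⟨r / 2, r, by positivity, by linarith⟩
  let ψ : 𝔼 → ℝ := convolution (ρ.normed volume) φ (ContinuousLinearMap.lsmul ℝ ℝ) volume
  have hL : LocallyIntegrable (ρ.normed (volume : Measure 𝔼)) volume :=
    ρ.continuous_normed.locallyIntegrable
  refine ⟨ψ, ?_, ?_, ?_⟩
  · exact ρ.hasCompactSupport_normed.contDiff_convolution_left _ ρ.contDiff_normed
      hφ.continuous.locallyIntegrable
  · have h1 : Function.support ψ ⊆ cthickening δ (tsupport φ) := by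
      refine (support_convolution_subset _).trans ?_
      rintro _ ⟨a, ha, b, hb, rfl⟩
      rw [ρ.support_normed_eq] at ha
      refine mem_cthickening_of_dist_le _ b δ _ (subset_tsupport _ hb) ?_
      simp only [dist_eq_norm, add_sub_cancel_right]
      have : ‖a‖ < r := by simpa using ha
      exact this.le.trans (min_le_left _ _)
    exact closure_minimal h1 isClosed_cthickening
  · intro x
    have := (hc.hasFDerivAt_convolution_right (ContinuousLinearMap.lsmul ℝ ℝ) hL hφ x).fderiv
    have h2 : ((ContinuousLinearMap.lsmul ℝ ℝ : ℝ →L[ℝ] ℝ →L[ℝ] ℝ).precompR 𝔼) =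
        (ContinuousLinearMap.lsmul ℝ ℝ) := by
      ext a f; rfl
    rw [h2] at this
    change fderiv ℝ ψ x = _ at this
    rw [this, ← dist_eq_norm]
    refine ρ.dist_normed_convolution_le hcf.aestronglyMeasurable ?_
    intro y hy
    exact (hηε (lt_of_lt_of_le hy (min_le_right _ _))).le

lemma IsPosWeakSol.isPHarmonic {p : ℝ} (hp : 2 ≤ p) {Ω : Set 𝔼} (hΩ : IsOpen Ω) {u : 𝔼 → ℝ}
    (h : IsPosWeakSol p (fun _ => 0) Ω u) : IsPHarmonic p Ω u := by
  obtain ⟨hu, -, hw⟩ := h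
  refine ⟨hu, fun φ hφ hc hs => ?_⟩
  have hsm : ∀ ψ : 𝔼 → ℝ, ContDiff ℝ (⊤ : ℕ∞) ψ → HasCompactSupport ψ → tsupport ψ ⊆ Ω →
      ∫ x, fderiv ℝ ψ x (pFlux p (gradient u x)) = 0 := by
    intro ψ hψ hψc hψs
    have h1 := hw ψ hψ hψc hψs
    rw [← h1, ← setIntegral_eq_integral_of_forall_compl_eq_zero (s := Ω)]
    · refine integral_congr_ae (Eventually.of_forall fun x => ?_)
      simp only [zero_mul, add_zero, pFlux, map_smul, smul_eq_mul]
      rw [inner_gradient_right]; simp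
    · intro x hx
      have : x ∉ tsupport (fderiv ℝ ψ) := fun h => hx (hψs (tsupport_fderiv_subset ℝ h))
      rw [image_eq_zero_of_notMem_tsupport this]; rfl
  obtain ⟨δ, hδ, hδΩ⟩ := hc.isCompact.exists_cthickening_subset_open hΩ hs
  set K := cthickening δ (tsupport φ) with hK
  have hKc : IsCompact K := hc.isCompact.cthickening
  have hfl : ContinuousOn (fun x => pFlux p (gradient u x)) K :=
    ((continuous_pFlux hp).comp_continuousOn (continuousOn_gradient hΩ hu)).mono hδΩ
  have hint : IntegrableOn (fun x => ‖pFlux p (gradient u x)‖) K :=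
    hfl.norm.integrableOn_compact hKc
  set I := ∫ x in K, ‖pFlux p (gradient u x)‖ with hI
  have hI0 : 0 ≤ I := integral_nonneg fun _ => norm_nonneg _
  have key : ∀ ε > 0, |∫ x, fderiv ℝ φ x (pFlux p (gradient u x))| ≤ ε * I := by
    intro ε hε
    obtain ⟨ψ, hψ, hψs, hψd⟩ := exists_smooth_approx hφ hc hδ hε
    have hψc : HasCompactSupport ψ := HasCompactSupport.of_support_subset_isCompact hKc
      ((subset_tsupport _).trans hψs)
    have h0 := hsm ψ hψ hψc (hψs.trans hδΩ)
    have i1 : Integrable fun x => fderiv ℝ φ x (pFlux p (gradient u x)) :=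
      (continuous_fderiv_pFlux hp hΩ hu hφ hs).integrable_of_hasCompactSupport
        ((hc.fderiv ℝ).mono fun x hx h => hx (by simp [h]))
    have i2 : Integrable fun x => fderiv ℝ ψ x (pFlux p (gradient u x)) :=
      (continuous_fderiv_pFlux hp hΩ hu (hψ.of_le (by exact_mod_cast le_top)) (hψs.trans
        hδΩ)).integrable_of_hasCompactSupport
        ((hψc.fderiv ℝ).mono fun x hx h => hx (by simp [h]))
    have h3 : ∫ x, fderiv ℝ φ x (pFlux p (gradient u x)) =
        - ∫ x in K, (fderiv ℝ ψ x - fderiv ℝ φ x) (pFlux p (gradient u x)) := by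
      rw [setIntegral_eq_integral_of_forall_compl_eq_zero (s := K)]
      · simp only [sub_apply]
        rw [integral_sub i2 i1, h0]; ring
      · intro x hx
        have a1 : x ∉ tsupport (fderiv ℝ ψ) := fun h => hx (hψs (tsupport_fderiv_subset ℝ h))
        have a2 : x ∉ tsupport (fderiv ℝ φ) := fun h => hx
          (self_subset_cthickening _ (tsupport_fderiv_subset ℝ h))
        rw [image_eq_zero_of_notMem_tsupport a1, image_eq_zero_of_notMem_tsupport a2]; simp
    rw [h3, abs_neg, ← Real.norm_eq_abs, hI, ← integral_const_mul]
    refine norm_integral_le_of_norm_le (hint.const_mul ε) (Eventually.of_forall fun x => ?_)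
    exact ((fderiv ℝ ψ x - fderiv ℝ φ x).le_opNorm _).trans
      (mul_le_mul_of_nonneg_right (hψd x) (norm_nonneg _))
  by_contra hne
  have hpos : 0 < |∫ x, fderiv ℝ φ x (pFlux p (gradient u x))| := abs_pos.2 hne
  set J := |∫ x, fderiv ℝ φ x (pFlux p (gradient u x))|
  have := key (J / (2 * (I + 1))) (by positivity)
  have h5 : J / (2 * (I + 1)) * I ≤ J / 2 := by
    rw [div_mul_eq_mul_div, div_le_div_iff₀ (by positivity) (by positivity)]
    nlinarith
  linarith

lemma inner_pFlux_sub (p : ℝ) (a b : 𝔼) :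
    ⟪a - b, pFlux p a - pFlux p b⟫ = (‖a‖ ^ (p - 2) + ‖b‖ ^ (p - 2)) / 2 * ‖a - b‖ ^ 2 +
      (‖a‖ ^ (p - 2) - ‖b‖ ^ (p - 2)) * (‖a‖ ^ 2 - ‖b‖ ^ 2) / 2 := by
  rw [@norm_sub_sq_real]
  simp only [pFlux, inner_sub_left, inner_sub_right, inner_smul_right,
    real_inner_self_eq_norm_sq, real_inner_comm a b]
  ring

lemma rpow_sub_mul_sq_sub_nonneg {p s t : ℝ} (hp : 2 ≤ p) (hs : 0 ≤ s) (ht : 0 ≤ t) :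
    0 ≤ (s ^ (p - 2) - t ^ (p - 2)) * (s ^ 2 - t ^ 2) := by
  rcases le_total s t with h | h
  · exact mul_nonneg_of_nonpos_of_nonpos
      (sub_nonpos.2 (Real.rpow_le_rpow hs h (by linarith)))
      (sub_nonpos.2 (pow_le_pow_left₀ hs h 2))
  · exact mul_nonneg (sub_nonneg.2 (Real.rpow_le_rpow ht h (by linarith)))
      (sub_nonneg.2 (pow_le_pow_left₀ ht h 2))

lemma inner_pFlux_sub_nonneg {p : ℝ} (hp : 2 ≤ p) (a b : 𝔼) :
    0 ≤ ⟪a - b, pFlux p a - pFlux p b⟫ := by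
  rw [inner_pFlux_sub]
  have := rpow_sub_mul_sq_sub_nonneg hp (norm_nonneg a) (norm_nonneg b)
  positivity

lemma eq_of_inner_pFlux_sub_eq_zero {p : ℝ} (hp : 2 ≤ p) {a b : 𝔼}
    (h : ⟪a - b, pFlux p a - pFlux p b⟫ = 0) : a = b := by
  rw [inner_pFlux_sub] at h
  have h1 := rpow_sub_mul_sq_sub_nonneg hp (norm_nonneg a) (norm_nonneg b)
  have h2 : (‖a‖ ^ (p - 2) + ‖b‖ ^ (p - 2)) / 2 * ‖a - b‖ ^ 2 = 0 := by
    have : 0 ≤ (‖a‖ ^ (p - 2) + ‖b‖ ^ (p - 2)) / 2 * ‖a - b‖ ^ 2 := by positivity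
    linarith
  rcases mul_eq_zero.1 h2 with h3 | h3
  · have ha : ‖a‖ ^ (p - 2) = 0 := by
      have := Real.rpow_nonneg (norm_nonneg a) (p - 2)
      have := Real.rpow_nonneg (norm_nonneg b) (p - 2)
      linarith
    have hb : ‖b‖ ^ (p - 2) = 0 := by
      have := Real.rpow_nonneg (norm_nonneg a) (p - 2)
      have := Real.rpow_nonneg (norm_nonneg b) (p - 2)
      linarith
    rw [norm_eq_zero.1 (Real.rpow_eq_zero_iff_of_nonneg (norm_nonneg _) |>.1 ha).1,
      norm_eq_zero.1 (Real.rpow_eq_zero_iff_of_nonneg (norm_nonneg _) |>.1 hb).1]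
  · exact sub_eq_zero.1 (norm_eq_zero.1 (pow_eq_zero_iff (two_ne_zero) |>.1 h3))

lemma hasDerivAt_max_zero_sq (t : ℝ) :
    HasDerivAt (fun t : ℝ => max t 0 ^ 2) (2 * max t 0) t := by
  rcases lt_trichotomy t 0 with h | rfl | h
  · rw [max_eq_right h.le, mul_zero]
    refine (hasDerivAt_const t (0 : ℝ)).congr_of_eventuallyEq ?_
    filter_upwards [Iio_mem_nhds h] with s hs
    simp [max_eq_right (le_of_lt (mem_Iio.1 hs))]
  · rw [hasDerivAt_iff_isLittleO]
    simp only [max_self, mul_zero, sub_zero, smul_zero, ne_eq, OfNat.ofNat_ne_zero,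
      not_false_eq_true, zero_pow]
    refine (Asymptotics.IsBigO.of_bound 1 (Eventually.of_forall fun s => ?_)).trans_isLittleO
      (Asymptotics.isLittleO_pow_id (one_lt_two) : (fun s : ℝ => s ^ 2) =o[𝓝 0] fun s => s)
    simp only [norm_pow, Real.norm_eq_abs, one_mul]
    refine pow_le_pow_left₀ (abs_nonneg _) ?_ 2
    rw [abs_of_nonneg (le_max_right _ _)]
    exact max_le (le_abs_self _) (abs_nonneg _)
  · rw [max_eq_left h.le]
    have := hasDerivAt_pow 2 t
    norm_num at this
    refine this.congr_of_eventuallyEq ?_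
    filter_upwards [Ioi_mem_nhds h] with s hs
    simp [max_eq_left (le_of_lt (mem_Ioi.1 hs))]

/-- A coordinatewise divergence theorem for compactly supported test functions. -/
lemma integral_fderiv_apply_eq_neg_integral_div {D K : Set 𝔼} (hD : IsOpen D)
    (hK : IsCompact K) (hKD : K ⊆ D) {ψ : 𝔼 → ℝ} (hψ : ContDiff ℝ 1 ψ) (h0 : ∀ x ∉ K, ψ x = 0)
    {F : 𝔼 → 𝔼} {F' : 𝔼 → 𝔼 →L[ℝ] 𝔼} (hF : ∀ x ∈ D, HasFDerivAt F (F' x) x)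
    (hF' : ContinuousOn F' D) :
    ∫ x, fderiv ℝ ψ x (F x) =
      - ∫ x, ψ x * ∑ i, F' x (EuclideanSpace.single i 1) i := by
  have hts : tsupport ψ ⊆ K := closure_minimal (fun x hx => by_contra fun h => hx (h0 x h))
    hK.isClosed
  have h0' : ∀ x ∉ K, fderiv ℝ ψ x = 0 := fun x hx =>
    image_eq_zero_of_notMem_tsupport fun h => hx (hts (tsupport_fderiv_subset ℝ h))
  have hFc : ContinuousOn F D := fun x hx => (hF x hx).continuousAt.continuousWithinAt
  have intg : ∀ g : 𝔼 → ℝ, ContinuousOn g D → (∀ x ∉ K, g x = 0) → Integrable g := by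
    intro g hg hg0
    refine (continuous_of_continuousOn_of_zero hD hK.isClosed hKD hg
      hg0).integrable_of_hasCompactSupport ?_
    exact HasCompactSupport.intro hK hg0
  have hci : ∀ i : Fin d, ContinuousOn (fun x => F x i) D := fun i =>
    (EuclideanSpace.proj i : 𝔼 →L[ℝ] ℝ).continuous.comp_continuousOn hFc
  have hc'i : ∀ i : Fin d, ContinuousOn (fun x => F' x (EuclideanSpace.single i 1) i) D := fun i =>
    (EuclideanSpace.proj i : 𝔼 →L[ℝ] ℝ).continuous.comp_continuousOn
      (hF'.clm_apply continuousOn_const)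
  have hdi : ∀ i : Fin d, ContinuousOn (fun x => fderiv ℝ ψ x (EuclideanSpace.single i 1)) D :=
    fun i => (hψ.continuous_fderiv one_ne_zero).continuousOn.clm_apply continuousOn_const
  have e1 : ∀ x, fderiv ℝ ψ x (F x) =
      ∑ i, F x i * fderiv ℝ ψ x (EuclideanSpace.single i 1) := by
    intro x
    conv_lhs => rw [← (EuclideanSpace.basisFun (Fin d) ℝ).sum_repr (F x)]
    simp [map_sum]
  simp_rw [e1, Finset.mul_sum]
  rw [integral_finsetSum, integral_finsetSum, ← Finset.sum_neg_distrib]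
  · refine Finset.sum_congr rfl fun i _ => ?_
    have := integral_bilinear_hasLineDerivAt_right_eq_neg_left_of_integrable
      (μ := (volume : Measure 𝔼)) (f := fun x => F x i)
      (f' := fun x => F' x (EuclideanSpace.single i 1) i)
      (g := ψ) (g' := fun x => fderiv ℝ ψ x (EuclideanSpace.single i 1))
      (v := EuclideanSpace.single i 1) (B := ContinuousLinearMap.mul ℝ ℝ) ?_ ?_ ?_ ?_ ?_
    · simp only [ContinuousLinearMap.mul_apply'] at this
      rw [this]
      simp_rw [mul_comm]
    · exact intg _ ((hc'i i).mul hψ.continuous.continuousOn) fun x hx => by simp [h0 x hx]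
    · exact intg _ ((hci i).mul (hdi i)) fun x hx => by simp [h0' x hx]
    · exact intg _ ((hci i).mul hψ.continuous.continuousOn) fun x hx => by simp [h0 x hx]
    · intro x hx
      have h1 : HasFDerivAt (fun x => F x i)
          ((EuclideanSpace.proj i : 𝔼 →L[ℝ] ℝ).comp (F' x)) x :=
        (EuclideanSpace.proj i : 𝔼 →L[ℝ] ℝ).hasFDerivAt.comp x (hF x (hKD (hts hx)))
      exact h1.hasLineDerivAt _
    · intro x _
      exact ((hψ.differentiable one_ne_zero) x).hasFDerivAt.hasLineDerivAt _
  · intro i _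
    exact intg _ (hψ.continuous.continuousOn.mul (hc'i i)) fun x hx => by simp [h0 x hx]
  · intro i _
    exact intg _ ((hci i).mul (hdi i)) fun x hx => by simp [h0' x hx]

/-- Comparison with a classical subsolution `w` with gradient `v`. -/
theorem IsPHarmonic.le_of_subsolution [NeZero d] {p : ℝ} (hp : 2 ≤ p) {Ω : Set 𝔼} (hΩ : IsOpen Ω)
    {u : 𝔼 → ℝ} (hu : IsPHarmonic p Ω u) {D : Set 𝔼} (hD : IsOpen D)
    (hDb : Bornology.IsBounded D) (hDΩ : closure D ⊆ Ω) {w : 𝔼 → ℝ} {v : 𝔼 → 𝔼}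
    {F' : 𝔼 → 𝔼 →L[ℝ] 𝔼} (hw : ∀ x ∈ D, HasGradientAt w (v x) x) (hv : ContinuousOn v D)
    (hF : ∀ x ∈ D, HasFDerivAt (fun x => pFlux p (v x)) (F' x) x) (hF' : ContinuousOn F' D)
    (hdiv : ∀ x ∈ D, 0 ≤ ∑ i, F' x (EuclideanSpace.single i 1) i)
    (hwc : ContinuousOn w (closure D)) (hb : ∀ x ∈ frontier D, w x ≤ u x) :
    ∀ x ∈ D, w x ≤ u x := by
  intro x₀ hx₀
  by_contra hlt
  push Not at hlt
  obtain ⟨hu1, hu2⟩ := hu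
  set ε := (w x₀ - u x₀) / 2 with hε
  have hε0 : 0 < ε := by rw [hε]; linarith
  set f : 𝔼 → ℝ := fun x => w x - u x - ε with hf
  have hfc : ContinuousOn f (closure D) :=
    (hwc.sub (hu1.continuousOn.mono hDΩ)).sub continuousOn_const
  have hDc : IsCompact (closure D) := hDb.isCompact_closure
  set K := closure D ∩ f ⁻¹' (Ici 0) with hK
  have hKc : IsCompact K := hDc.of_isClosed_subset
    (hfc.preimage_isClosed_of_isClosed isClosed_closure isClosed_Ici) inter_subset_left
  have hKD : K ⊆ D := by
    rintro x ⟨hx1, hx2⟩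
    by_contra hx
    have := hb x ⟨hx1, by rwa [hD.interior_eq]⟩
    simp only [hf, mem_preimage, mem_Ici] at hx2
    linarith
  have hDΩ' : D ⊆ Ω := subset_closure.trans hDΩ
  set ψ : 𝔼 → ℝ := D.indicator fun x => max (f x) 0 ^ 2 with hψdef
  have hψ0 : ∀ x ∉ K, ψ x = 0 := by
    intro x hx
    by_cases hxD : x ∈ D
    · rw [hψdef, indicator_of_mem hxD]
      have : f x < 0 := by
        by_contra h
        exact hx ⟨subset_closure hxD, not_lt.1 h⟩
      simp [max_eq_right this.le]
    · exact indicator_of_notMem hxD _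
  have hug : ∀ x ∈ D, HasGradientAt u (gradient u x) x := fun x hx =>
    ((hu1.contDiffAt (hΩ.mem_nhds (hDΩ' hx))).differentiableAt one_ne_zero).hasGradientAt
  have hfd : ∀ x ∈ D, HasFDerivAt f
      ((InnerProductSpace.toDual ℝ 𝔼) (v x - gradient u x)) x := by
    intro x hx
    rw [map_sub]
    exact ((hw x hx).hasFDerivAt.sub (hug x hx).hasFDerivAt).sub_const ε
  have hψd : ∀ x ∈ D, HasFDerivAt ψ
      ((2 * max (f x) 0) • (InnerProductSpace.toDual ℝ 𝔼) (v x - gradient u x)) x := by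
    intro x hx
    refine ((hasDerivAt_max_zero_sq (f x)).comp_hasFDerivAt x (hfd x hx)).congr_of_eventuallyEq ?_
    filter_upwards [hD.mem_nhds hx] with y hy
    rw [hψdef, indicator_of_mem hy]; rfl
  have hψz : ∀ x ∉ K, HasFDerivAt ψ (0 : 𝔼 →L[ℝ] ℝ) x := by
    intro x hx
    refine (hasFDerivAt_const (0 : ℝ) x).congr_of_eventuallyEq ?_
    filter_upwards [hKc.isClosed.isOpen_compl.mem_nhds hx] with y hy
    exact hψ0 y hy
  have hguc : ContinuousOn (gradient u) D := (continuousOn_gradient hΩ hu1).mono hDΩ'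
  have hψC : ContDiff ℝ 1 ψ := by
    rw [contDiff_one_iff_fderiv]
    constructor
    · intro x
      by_cases hx : x ∈ K
      · exact (hψd x (hKD hx)).differentiableAt
      · exact (hψz x hx).differentiableAt
    · refine continuous_of_continuousOn_of_zero hD hKc.isClosed hKD ?_ fun x hx => (hψz x hx).fderiv
      have : ContinuousOn (fun x => (2 * max (f x) 0) •
          (InnerProductSpace.toDual ℝ 𝔼) (v x - gradient u x)) D := by
        refine ContinuousOn.smul (continuousOn_const.mul
          ((hfc.mono subset_closure).sup continuousOn_const)) ?_
        exact (InnerProductSpace.toDual ℝ 𝔼).continuous.comp_continuousOn (hv.sub hguc)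
      exact this.congr fun x hx => (hψd x hx).fderiv
  have hψc : HasCompactSupport ψ := HasCompactSupport.intro hKc hψ0
  have hts : tsupport ψ ⊆ K := closure_minimal (fun x hx => by_contra fun h => hx (hψ0 x h))
    hKc.isClosed
  have hψz' : ∀ x ∉ K, fderiv ℝ ψ x = 0 := fun x hx => (hψz x hx).fderiv
  have hI1 := hu2 ψ hψC hψc (hts.trans (hKD.trans hDΩ'))
  have hI2 : ∫ x, fderiv ℝ ψ x (pFlux p (v x)) ≤ 0 := by
    rw [integral_fderiv_apply_eq_neg_integral_div hD hKc hKD hψC hψ0 hF hF', neg_nonpos]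
    refine integral_nonneg fun x => ?_
    by_cases hx : x ∈ D
    · refine mul_nonneg ?_ (hdiv x hx)
      rw [hψdef, indicator_of_mem hx]; positivity
    · simp [hψ0 x fun h => hx (hKD h)]
  have hdc : ContinuousOn (fderiv ℝ ψ) D := (hψC.continuous_fderiv one_ne_zero).continuousOn
  have hvc : ContinuousOn (fun x => pFlux p (v x)) D := (continuous_pFlux hp).comp_continuousOn hv
  have hgc : ContinuousOn (fun x => pFlux p (gradient u x)) D :=
    (continuous_pFlux hp).comp_continuousOn hguc
  have cont : ∀ g : 𝔼 → 𝔼, ContinuousOn g D → Continuous fun x => fderiv ℝ ψ x (g x) :=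
    fun g hg => continuous_of_continuousOn_of_zero hD hKc.isClosed hKD (hdc.clm_apply hg)
      fun x hx => by simp [hψz' x hx]
  have intg : ∀ g : 𝔼 → 𝔼, ContinuousOn g D → Integrable fun x => fderiv ℝ ψ x (g x) :=
    fun g hg => (cont g hg).integrable_of_hasCompactSupport
      (HasCompactSupport.intro hKc fun x hx => by simp [hψz' x hx])
  set J : 𝔼 → ℝ := fun x => fderiv ℝ ψ x (pFlux p (v x) - pFlux p (gradient u x)) with hJ
  have hJD : ∀ x ∈ D, J x = 2 * max (f x) 0 *
      ⟪v x - gradient u x, pFlux p (v x) - pFlux p (gradient u x)⟫ := by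
    intro x hx
    simp only [hJ]
    rw [(hψd x hx).fderiv, smul_apply, InnerProductSpace.toDual_apply_apply,
      smul_eq_mul]
  have hJ0 : 0 ≤ J := by
    intro x
    by_cases hx : x ∈ D
    · rw [Pi.zero_apply, hJD x hx]
      exact mul_nonneg (by positivity) (inner_pFlux_sub_nonneg hp _ _)
    · simp [hJ, hψz' x fun h => hx (hKD h)]
  have hJint : ∫ x, J x ≤ 0 := by
    simp only [hJ, map_sub]
    rw [integral_sub (intg _ hvc) (intg _ hgc), hI1]; linarith
  have hJz : J = 0 := by
    have h1 : ∫ x, J x = 0 := le_antisymm hJint (integral_nonneg hJ0)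
    have h2 := (integral_eq_zero_iff_of_nonneg hJ0 (intg _ (hvc.sub hgc))).1 h1
    exact (Continuous.ae_eq_iff_eq volume (cont _ (hvc.sub hgc)) continuous_const).1 h2
  have hder : ∀ x, fderiv ℝ ψ x = 0 := by
    intro x
    by_cases hx : x ∈ D
    · have h1 := congrFun hJz x
      rw [hJD x hx, Pi.zero_apply, mul_eq_zero] at h1
      rw [(hψd x hx).fderiv]
      rcases h1 with h1 | h1
      · rw [h1, zero_smul]
      · rw [eq_of_inner_pFlux_sub_eq_zero hp h1]; simp
    · exact hψz' x fun h => hx (hKD h)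
  obtain ⟨y, hy⟩ : ∃ y, y ∉ K := by
    by_contra h
    push Not at h
    exact noncompact_univ 𝔼 (by rwa [eq_univ_of_forall h] at hKc)
  have := is_const_of_fderiv_eq_zero (hψC.differentiable one_ne_zero) hder x₀ y
  rw [hψ0 y hy, hψdef, indicator_of_mem hx₀] at this
  have hfx : f x₀ = ε := by simp only [hf, hε]; ring
  rw [hfx, max_eq_left hε0.le] at this
  exact (pow_pos hε0 2).ne' this

lemma pFlux_smul (p c : ℝ) (v : 𝔼) : pFlux p (c • v) = (|c| ^ (p - 2) * c) • pFlux p v := by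
  simp only [pFlux, norm_smul, Real.norm_eq_abs, smul_smul]
  rw [Real.mul_rpow (abs_nonneg _) (norm_nonneg _)]
  ring_nf

/-- The class of `p`-harmonic functions is invariant under dilations and affine changes. -/
lemma IsPHarmonic.comp_smul {p : ℝ} {Ω : Set 𝔼} (hΩ : IsOpen Ω) {u : 𝔼 → ℝ}
    (hu : IsPHarmonic p Ω u) {R : ℝ} (hR : 0 < R) (k c : ℝ) :
    IsPHarmonic p ((fun x => R • x) ⁻¹' Ω) fun x => k * u (R • x) + c := by
  obtain ⟨hu1, hu2⟩ := hu
  have hsm : ContDiff ℝ 1 fun x : 𝔼 => R • x := contDiff_const_smul R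
  refine ⟨(contDiffOn_const.mul (hu1.comp hsm.contDiffOn fun x hx => hx)).add contDiffOn_const,
    fun φ hφ hc hs => ?_⟩
  have hRi : ContDiff ℝ 1 fun x : 𝔼 => R⁻¹ • x := contDiff_const_smul R⁻¹
  have hgrad : ∀ x ∈ (fun x => R • x) ⁻¹' Ω,
      gradient (fun x => k * u (R • x) + c) x = (k * R) • gradient u (R • x) := by
    intro x hx
    have h1 : HasFDerivAt u (fderiv ℝ u (R • x)) (R • x) :=
      ((hu1.contDiffAt (hΩ.mem_nhds hx)).differentiableAt one_ne_zero).hasFDerivAt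
    have h2 : HasFDerivAt (fun x : 𝔼 => R • x) (R • ContinuousLinearMap.id ℝ 𝔼) x :=
      (hasFDerivAt_id x).const_smul R
    have h3 := ((h1.comp x h2).const_mul k).add_const c
    refine HasGradientAt.gradient ?_
    rw [hasGradientAt_iff_hasFDerivAt]
    refine HasFDerivAt.congr_fderiv h3 ?_
    ext y
    simp [gradient, mul_assoc]
  have hfd : ∀ x, fderiv ℝ (fun x => φ (R⁻¹ • x)) x = R⁻¹ • fderiv ℝ φ (R⁻¹ • x) := by
    intro x
    have h2 : HasFDerivAt (fun x : 𝔼 => R⁻¹ • x) (R⁻¹ • ContinuousLinearMap.id ℝ 𝔼) x :=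
      (hasFDerivAt_id x).const_smul R⁻¹
    have h1 := ((hφ.differentiable one_ne_zero) (R⁻¹ • x)).hasFDerivAt.comp x h2
    refine h1.fderiv.trans ?_
    ext y; simp
  have h0 := hu2 (fun x => φ (R⁻¹ • x)) (hφ.comp hRi)
    (hc.comp_homeomorph (Homeomorph.smulOfNeZero R⁻¹ (inv_ne_zero hR.ne'))) (by
      intro x hx
      have := hs (tsupport_comp_subset_preimage (f := fun x : 𝔼 => R⁻¹ • x) φ hRi.continuous hx)
      simpa [smul_smul, hR.ne'] using this)
  simp_rw [hfd] at h0
  set g : 𝔼 → ℝ := fun x => fderiv ℝ φ (R⁻¹ • x) (pFlux p (gradient u x)) with hg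
  have h1 : ∫ x, g x = 0 := by
    have : ∀ x, (R⁻¹ • fderiv ℝ φ (R⁻¹ • x)) (pFlux p (gradient u x)) = R⁻¹ * g x := fun x => rfl
    simp_rw [this] at h0
    rw [integral_const_mul] at h0
    exact (mul_eq_zero.1 h0).resolve_left (inv_ne_zero hR.ne')
  have h2 : ∫ x, g (R • x) = 0 := by
    rw [Measure.integral_comp_smul, h1, smul_zero]
  have h3 : ∀ x, fderiv ℝ φ x (pFlux p (gradient (fun x => k * u (R • x) + c) x)) =
      (|k * R| ^ (p - 2) * (k * R)) * g (R • x) := by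
    intro x
    by_cases hx : x ∈ tsupport φ
    · rw [hgrad x (hs hx), pFlux_smul]
      simp [hg, smul_smul, hR.ne']
    · have : x ∉ tsupport (fderiv ℝ φ) := fun h => hx (tsupport_fderiv_subset ℝ h)
      have hz := image_eq_zero_of_notMem_tsupport this
      simp [hg, smul_smul, hR.ne', hz]
  simp_rw [h3]
  rw [integral_const_mul, h2, mul_zero]

lemma IsPHarmonic.neg {p : ℝ} {Ω : Set 𝔼} (hΩ : IsOpen Ω) {u : 𝔼 → ℝ}
    (hu : IsPHarmonic p Ω u) : IsPHarmonic p Ω fun x => -u x := by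
  have := hu.comp_smul hΩ one_pos (-1) 0
  simpa using this

lemma hasFDerivAt_norm_sub_rpow (β : ℝ) {x z : 𝔼} (hx : x ≠ z) :
    HasFDerivAt (fun x : 𝔼 => ‖x - z‖ ^ β)
      ((β * ‖x - z‖ ^ (β - 2)) • innerSL ℝ (x - z)) x := by
  have h0 : 0 < ‖x - z‖ := norm_pos_iff.2 (sub_ne_zero.2 hx)
  have h1 : HasFDerivAt (fun x : 𝔼 => ‖x - z‖ ^ 2) (2 • (innerSL ℝ (x - z))) x := by
    have := (hasStrictFDerivAt_norm_sq (x - z)).hasFDerivAt.comp x ((hasFDerivAt_id x).sub_const z)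
    exact this
  have h2 : HasDerivAt (fun t : ℝ => t ^ (β / 2)) (β / 2 * (‖x - z‖ ^ 2) ^ (β / 2 - 1))
      (‖x - z‖ ^ 2) := Real.hasDerivAt_rpow_const (Or.inl (by positivity))
  have h3 := h2.comp_hasFDerivAt x h1
  have e : ∀ t : ℝ, 0 ≤ t → ∀ s : ℝ, (t ^ 2) ^ (s / 2) = t ^ s := by
    intro t ht s
    rw [← Real.rpow_natCast, ← Real.rpow_mul ht]; congr 1; push_cast; ring
  have hf : (fun x : 𝔼 => ‖x - z‖ ^ β) = (fun t : ℝ => t ^ (β / 2)) ∘ fun x => ‖x - z‖ ^ 2 := by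
    funext y; exact (e _ (norm_nonneg _) β).symm
  rw [hf]
  refine h3.congr_fderiv ?_
  rw [show β / 2 - 1 = (β - 2) / 2 by ring, e _ (norm_nonneg _)]
  ext y; simp; ring

lemma hasGradientAt_norm_sub_rpow (β : ℝ) {x z : 𝔼} (hx : x ≠ z) :
    HasGradientAt (fun x : 𝔼 => ‖x - z‖ ^ β) ((β * ‖x - z‖ ^ (β - 2)) • (x - z)) x := by
  rw [hasGradientAt_iff_hasFDerivAt]
  refine (hasFDerivAt_norm_sub_rpow β hx).congr_fderiv ?_
  ext y; simp

lemma hasGradientAt_log_norm_sub {x z : 𝔼} (hx : x ≠ z) :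
    HasGradientAt (fun x : 𝔼 => Real.log ‖x - z‖) ((‖x - z‖ ^ (-2 : ℝ)) • (x - z)) x := by
  have h0 : 0 < ‖x - z‖ := norm_pos_iff.2 (sub_ne_zero.2 hx)
  rw [hasGradientAt_iff_hasFDerivAt]
  have h1 := hasFDerivAt_norm_sub_rpow 1 hx
  simp only [Real.rpow_one] at h1
  have h3 := (Real.hasDerivAt_log h0.ne').comp_hasFDerivAt x h1
  refine h3.congr_fderiv ?_
  have : ‖x - z‖ ^ (-2 : ℝ) = ‖x - z‖⁻¹ * ‖x - z‖ ^ ((1 : ℝ) - 2) := by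
    rw [show (-2 : ℝ) = -1 + (1 - 2) by norm_num, Real.rpow_add h0, Real.rpow_neg_one]
  ext y; simp [this]; ring

/-- The derivative of the vector field `x ↦ ‖x - z‖ ^ β • (x - z)`. -/
def radialFieldDeriv (β : ℝ) (z x : 𝔼) : 𝔼 →L[ℝ] 𝔼 :=
  ‖x - z‖ ^ β • ContinuousLinearMap.id ℝ 𝔼 +
    ((β * ‖x - z‖ ^ (β - 2)) • innerSL ℝ (x - z)).smulRight (x - z)

lemma hasFDerivAt_radialField (β : ℝ) {x z : 𝔼} (hx : x ≠ z) :
    HasFDerivAt (fun x : 𝔼 => ‖x - z‖ ^ β • (x - z)) (radialFieldDeriv β z x) x :=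
  (hasFDerivAt_norm_sub_rpow β hx).smul ((hasFDerivAt_id x).sub_const z)

lemma continuousOn_norm_sub_rpow (β : ℝ) (z : 𝔼) :
    ContinuousOn (fun x : 𝔼 => ‖x - z‖ ^ β) {z}ᶜ := by
  refine ContinuousOn.rpow_const (by fun_prop) fun x hx => Or.inl ?_
  exact (norm_pos_iff.2 (sub_ne_zero.2 hx)).ne'

lemma continuousOn_radialFieldDeriv (β : ℝ) (z : 𝔼) :
    ContinuousOn (radialFieldDeriv β z) {z}ᶜ := by
  unfold radialFieldDeriv
  have h1 := continuousOn_norm_sub_rpow β z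
  have h2 := continuousOn_norm_sub_rpow (β - 2) z
  have hsub : ContinuousOn (fun x : 𝔼 => x - z) {z}ᶜ := by fun_prop
  have h3 : ContinuousOn (fun x : 𝔼 => innerSL ℝ (x - z)) {z}ᶜ :=
    (innerSL ℝ).continuous.comp_continuousOn hsub
  have h4 : ContinuousOn (fun x : 𝔼 => (β * ‖x - z‖ ^ (β - 2)) • innerSL ℝ (x - z)) {z}ᶜ :=
    (continuousOn_const.mul h2).smul h3
  refine (h1.smul continuousOn_const).add ?_
  exact (ContinuousLinearMap.smulRightL ℝ 𝔼 𝔼).continuous₂.comp_continuousOn (h4.prodMk hsub)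

lemma sum_radialFieldDeriv (β : ℝ) {x z : 𝔼} (hx : x ≠ z) :
    ∑ i, radialFieldDeriv β z x (EuclideanSpace.single i 1) i = (d + β) * ‖x - z‖ ^ β := by
  have h0 : 0 < ‖x - z‖ := norm_pos_iff.2 (sub_ne_zero.2 hx)
  have h1 : ∀ i : Fin d, radialFieldDeriv β z x (EuclideanSpace.single i 1) i =
      ‖x - z‖ ^ β + β * ‖x - z‖ ^ (β - 2) * (‖(x - z) i‖ ^ 2) := by
    intro i
    simp [radialFieldDeriv, EuclideanSpace.inner_single_right]
    ring
  simp_rw [h1]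
  rw [Finset.sum_add_distrib, ← Finset.mul_sum, ← EuclideanSpace.norm_sq_eq, mul_assoc,
    ← Real.rpow_natCast, ← Real.rpow_add h0]
  simp
  ring

/-- The radial profile of the fundamental solution of the `p`-Laplacian for `p ≥ d`. -/
def radialGauge (d : ℕ) (p r : ℝ) : ℝ :=
  if (d : ℝ) < p then r ^ ((p - d) / (p - 1)) else Real.log r

lemma exists_hasGradientAt_radialGauge (hd : 2 ≤ d) {p : ℝ} (hp : d ≤ p) :
    ∃ κ : ℝ, 0 < κ ∧ ∀ x z : 𝔼, x ≠ z → HasGradientAt (fun x : 𝔼 => radialGauge d p ‖x - z‖)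
      ((κ * ‖x - z‖ ^ ((p - d) / (p - 1) - 2)) • (x - z)) x := by
  have hd' : (2 : ℝ) ≤ d := by exact_mod_cast hd
  by_cases h : (d : ℝ) < p
  · refine ⟨(p - d) / (p - 1), div_pos (by linarith) (by linarith), fun x z hx => ?_⟩
    simp only [radialGauge, h, if_true]
    exact hasGradientAt_norm_sub_rpow _ hx
  · refine ⟨1, one_pos, fun x z hx => ?_⟩
    have : p = d := le_antisymm (not_lt.1 h) hp
    simp only [radialGauge, h, if_false]
    simpa [this] using hasGradientAt_log_norm_sub hx

lemma IsPHarmonic.radial_le (hd : 2 ≤ d) {p : ℝ} (hp : d ≤ p) {Ω D : Set 𝔼} {u : 𝔼 → ℝ}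
    (hΩ : IsOpen Ω) (hu : IsPHarmonic p Ω u) (hD : IsOpen D) (hDb : Bornology.IsBounded D)
    (hDΩ : closure D ⊆ Ω) {z : 𝔼} (hz : z ∉ D) {A c : ℝ}
    (hc : ContinuousOn (fun x => A + c * radialGauge d p ‖x - z‖) (closure D))
    (hb : ∀ x ∈ frontier D, A + c * radialGauge d p ‖x - z‖ ≤ u x) {x : 𝔼} (hx : x ∈ D) :
    A + c * radialGauge d p ‖x - z‖ ≤ u x := by
  have : NeZero d := ⟨by omega⟩
  have hd' : (2 : ℝ) ≤ d := by exact_mod_cast hd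
  have hDz : D ⊆ {z}ᶜ := fun y hy h => hz (h ▸ hy)
  obtain ⟨κ, -, hκ⟩ := exists_hasGradientAt_radialGauge (d := d) hd hp
  set α := (p - d) / (p - 1) with hα
  have hp1 : p - 1 ≠ 0 := by linarith
  set C := |c * κ| ^ (p - 2) * (c * κ) with hC
  have hflux : ∀ y ∈ D, pFlux p ((c * κ * ‖y - z‖ ^ (α - 2)) • (y - z)) =
      C • (‖y - z‖ ^ (-d : ℝ) • (y - z)) := by
    intro y hy
    have h0 : 0 < ‖y - z‖ := norm_pos_iff.2 (sub_ne_zero.2 (hDz hy))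
    rw [mul_smul, pFlux_smul, pFlux_smul, pFlux, smul_smul, smul_smul, smul_smul]
    congr 1
    rw [abs_of_nonneg (Real.rpow_nonneg h0.le _), ← hC, ← Real.rpow_mul h0.le, mul_assoc,
      ← Real.rpow_add h0,
      ← Real.rpow_add h0]
    congr 2
    rw [hα]; field_simp; ring
  refine hu.le_of_subsolution (hd'.trans hp) hΩ hD hDb hDΩ
    (v := fun y => (c * κ * ‖y - z‖ ^ (α - 2)) • (y - z))
    (F' := fun y => C • radialFieldDeriv (-d : ℝ) z y) ?_ ?_ ?_ ?_ ?_ hc hb x hx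
  · intro y hy
    have h1 := ((hκ y z (hDz hy)).hasFDerivAt.const_mul c).const_add A
    rw [hasGradientAt_iff_hasFDerivAt]
    refine h1.congr_fderiv ?_
    ext w; simp; ring
  · exact (continuousOn_const.mul ((continuousOn_norm_sub_rpow _ z).mono hDz)).smul (by fun_prop)
  · intro y hy
    have h1 := (hasFDerivAt_radialField (-d : ℝ) (hDz hy)).const_smul C
    refine h1.congr_of_eventuallyEq ?_
    filter_upwards [hD.mem_nhds hy] with w hw using hflux w hw
  · exact ((continuousOn_radialFieldDeriv _ z).mono hDz).const_smul C
  · intro y hy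
    have h1 := sum_radialFieldDeriv (-d : ℝ) (hDz hy)
    have h2 : ∑ i, (C • radialFieldDeriv (-d : ℝ) z y) (EuclideanSpace.single i 1) i =
        C * ∑ i, radialFieldDeriv (-d : ℝ) z y (EuclideanSpace.single i 1) i := by
      simp [Finset.mul_sum]
    rw [h2, h1]; simp

lemma sum_radialFieldDeriv_comp {p : ℝ} (β : ℝ) {v x z : 𝔼} (hv : v ≠ 0) (hx : x ≠ z) :
    ∑ i, (radialFieldDeriv (p - 2) 0 v (radialFieldDeriv β z x (EuclideanSpace.single i 1))) i =
      ‖v‖ ^ (p - 4) * ‖x - z‖ ^ (β - 2) * ((d + β + p - 2) * (‖x - z‖ ^ 2 * ‖v‖ ^ 2) +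
        (p - 2) * β * ⟪x - z, v⟫ ^ 2) := by
  have h0 : 0 < ‖x - z‖ := norm_pos_iff.2 (sub_ne_zero.2 hx)
  have hv0 : 0 < ‖v‖ := norm_pos_iff.2 hv
  have h1 : ∀ i : Fin d,
      (radialFieldDeriv (p - 2) 0 v (radialFieldDeriv β z x (EuclideanSpace.single i 1))) i =
      ‖v‖ ^ (p - 2) * ‖x - z‖ ^ β + ‖v‖ ^ (p - 2) * (β * ‖x - z‖ ^ (β - 2)) * ‖(x - z) i‖ ^ 2 +
        (p - 2) * ‖v‖ ^ (p - 4) * ‖x - z‖ ^ β * ‖v i‖ ^ 2 +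
        (p - 2) * ‖v‖ ^ (p - 4) * (β * ‖x - z‖ ^ (β - 2)) * ⟪x - z, v⟫ * ((x - z) i * v i) := by
    intro i
    simp [radialFieldDeriv, EuclideanSpace.inner_single_right, inner_add_right, inner_smul_right,
      real_inner_comm v (x - z), show p - 2 - 2 = p - 4 by ring]
    ring
  simp_rw [h1]
  have h2 : ∑ i, (x - z) i * v i = ⟪x - z, v⟫ := by
    simp [PiLp.inner_apply, mul_comm]
  rw [Finset.sum_add_distrib, Finset.sum_add_distrib, Finset.sum_add_distrib, ← Finset.mul_sum,
    ← Finset.mul_sum, ← Finset.mul_sum, ← Finset.mul_sum, ← EuclideanSpace.norm_sq_eq,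
    ← EuclideanSpace.norm_sq_eq,
    h2]
  have e1 : ‖v‖ ^ (p - 2) = ‖v‖ ^ (p - 4) * ‖v‖ ^ 2 := by
    rw [← Real.rpow_natCast, ← Real.rpow_add hv0]; congr 1; push_cast; ring
  have e2 : ‖x - z‖ ^ β = ‖x - z‖ ^ (β - 2) * ‖x - z‖ ^ 2 := by
    rw [← Real.rpow_natCast, ← Real.rpow_add h0]; congr 1; push_cast; ring
  rw [e1, e2]
  simp
  ring

lemma hasFDerivAt_pFlux (p : ℝ) {v : 𝔼} (hv : v ≠ 0) :
    HasFDerivAt (pFlux p) (radialFieldDeriv (p - 2) 0 v) v := by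
  have := hasFDerivAt_radialField (p - 2) hv
  simp only [sub_zero] at this
  exact this

/-- Comparison with the sum of a fundamental solution and a singular barrier. -/
lemma IsPHarmonic.barrier_le (hd : 2 ≤ d) {p : ℝ} (hp : d < p) {Ω D : Set 𝔼} {u : 𝔼 → ℝ}
    (hΩ : IsOpen Ω) (hu : IsPHarmonic p Ω u) (hD : IsOpen D) (hDb : Bornology.IsBounded D)
    (hDΩ : closure D ⊆ Ω) {y : 𝔼} (hy : y ∉ closure D) (h0 : (0 : 𝔼) ∉ closure D) {a b c : ℝ}
    (ha : 0 ≤ a) (hc : 0 < c)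
    (hv : ∀ x ∈ D, (a * ((p - d) / (p - 1)) * ‖x - 0‖ ^ ((p - d) / (p - 1) - 2)) • (x - 0) +
      (c * (-(d + p - 4)) * ‖x - y‖ ^ (-(d + p - 4) - 2 : ℝ)) • (x - y) ≠ 0)
    (hb : ∀ x ∈ frontier D, a * ‖x - 0‖ ^ ((p - d) / (p - 1)) +
      c * ‖x - y‖ ^ (-(d + p - 4) : ℝ) + b ≤ u x) {x : 𝔼} (hx : x ∈ D) :
    a * ‖x - 0‖ ^ ((p - d) / (p - 1)) + c * ‖x - y‖ ^ (-(d + p - 4) : ℝ) + b ≤ u x := by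
  have : NeZero d := ⟨by omega⟩
  have hd' : (2 : ℝ) ≤ d := by exact_mod_cast hd
  have hDy : closure D ⊆ {y}ᶜ := fun z hz h => hy (h ▸ hz)
  have hD0 : closure D ⊆ {0}ᶜ := fun z hz h => h0 (h ▸ hz)
  have hDy' := subset_closure.trans hDy
  have hD0' := subset_closure.trans hD0
  set q : ℝ := d + p - 4 with hq
  have hq0 : 0 < q := by linarith
  set α := (p - d) / (p - 1) with hα
  have hp1 : 0 < p - 1 := by linarith
  have hαe : α * (p - 1) = p - d := by rw [hα]; field_simp
  have hα0 : 0 < α := div_pos (by linarith) hp1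
  have hα1 : α < 1 := by rw [hα, div_lt_one hp1]; linarith
  set v : 𝔼 → 𝔼 := fun x => (a * α * ‖x - 0‖ ^ (α - 2)) • (x - 0) +
      (c * (-q) * ‖x - y‖ ^ (-q - 2 : ℝ)) • (x - y) with hvdef
  have hvc : ContinuousOn v D := by
    refine ContinuousOn.add ?_ ?_
    · exact (continuousOn_const.mul ((continuousOn_norm_sub_rpow _ 0).mono hD0')).smul (by fun_prop)
    · exact (continuousOn_const.mul ((continuousOn_norm_sub_rpow _ y).mono hDy')).smul (by fun_prop)
  refine hu.le_of_subsolution (hd'.trans hp.le) hΩ hD hDb hDΩ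
    (w := fun x => a * ‖x - 0‖ ^ α + c * ‖x - y‖ ^ (-q : ℝ) + b) (v := v)
    (F' := fun x => (radialFieldDeriv (p - 2) 0 (v x)).comp
      ((a * α) • radialFieldDeriv (α - 2) 0 x + (c * (-q)) • radialFieldDeriv (-q - 2) y x))
    ?_ hvc ?_ ?_ ?_ ?_ hb x hx
  · intro x hx
    have h1 := (hasGradientAt_norm_sub_rpow α (hD0' hx)).hasFDerivAt.const_mul a
    have h2 := (hasGradientAt_norm_sub_rpow (-q) (hDy' hx)).hasFDerivAt.const_mul c
    rw [hasGradientAt_iff_hasFDerivAt]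
    refine ((h1.add h2).add_const b).congr_fderiv ?_
    ext w; simp [hvdef]; ring
  · intro x hx
    have h1 : HasFDerivAt v
        ((a * α) • radialFieldDeriv (α - 2) 0 x +
          (c * (-q)) • radialFieldDeriv (-q - 2) y x) x := by
      have := ((hasFDerivAt_radialField (α - 2) (hD0' hx)).const_smul (a * α)).add
        ((hasFDerivAt_radialField (-q - 2) (hDy' hx)).const_smul (c * (-q)))
      refine this.congr_of_eventuallyEq (Eventually.of_forall fun z => ?_)
      simp [hvdef, mul_smul]
    exact (hasFDerivAt_pFlux p (hv x hx)).comp x h1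
  · refine ContinuousOn.clm_comp ?_ ?_
    · exact (continuousOn_radialFieldDeriv (p - 2) 0).comp hvc fun x hx => hv x hx
    · have h1 := ((continuousOn_radialFieldDeriv (α - 2) 0).mono hD0').const_smul (a * α)
      have h2 := ((continuousOn_radialFieldDeriv (-q - 2) y).mono hDy').const_smul (c * (-q))
      exact h1.add h2
  · intro x hx
    have h1 := sum_radialFieldDeriv_comp (p := p) (α - 2) (hv x hx) (hD0' hx)
    have h2 := sum_radialFieldDeriv_comp (p := p) (-q - 2) (hv x hx) (hDy' hx)
    have h3 : ∑ i, ((radialFieldDeriv (p - 2) 0 (v x)).comp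
      ((a * α) • radialFieldDeriv (α - 2) 0 x + (c * (-q)) • radialFieldDeriv (-q - 2) y x))
        (EuclideanSpace.single i 1) i = a * α * (∑ i, (radialFieldDeriv (p - 2) 0 (v x)
          (radialFieldDeriv (α - 2) 0 x (EuclideanSpace.single i 1))) i) +
        c * (-q) * (∑ i, (radialFieldDeriv (p - 2) 0 (v x)
          (radialFieldDeriv (-q - 2) y x (EuclideanSpace.single i 1))) i) := by
      simp [Finset.mul_sum, Finset.sum_add_distrib]
    rw [h3]
    have h1' : 0 ≤ ∑ i, (radialFieldDeriv (p - 2) 0 (v x)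
          (radialFieldDeriv (α - 2) 0 x (EuclideanSpace.single i 1))) i := by
      refine h1.symm ▸ mul_nonneg (by positivity) ?_
      have := abs_real_inner_le_norm (x - 0) (v x)
      have h5 : ⟪x - 0, v x⟫ ^ 2 ≤ ‖x - 0‖ ^ 2 * ‖v x‖ ^ 2 := by
        rw [← mul_pow, ← sq_abs]; gcongr
      have h6 : (d : ℝ) + (α - 2) + p - 2 = (p - 2) * (2 - α) := by linarith
      rw [h6]
      have : 0 ≤ (p - 2) * (2 - α) := mul_nonneg (by linarith) (by linarith)
      nlinarith
    have h2' : ∑ i, (radialFieldDeriv (p - 2) 0 (v x)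
          (radialFieldDeriv (-q - 2) y x (EuclideanSpace.single i 1))) i ≤ 0 := by
      refine h2.symm ▸ mul_nonpos_of_nonneg_of_nonpos (by positivity) ?_
      have h6 : (d : ℝ) + (-q - 2) + p - 2 = 0 := by rw [hq]; ring
      rw [h6]
      have : 0 ≤ (p - 2) * (q + 2) * ⟪x - y, v x⟫ ^ 2 :=
        mul_nonneg (mul_nonneg (by linarith) (by linarith)) (sq_nonneg _)
      linarith
    have h4 : 0 ≤ a * α := by positivity
    have h5 : 0 < c * q := by positivity
    nlinarith [mul_nonneg h4 h1', mul_nonneg h5.le (neg_nonneg.2 h2')]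
  · refine ContinuousOn.add (ContinuousOn.add ?_ ?_) continuousOn_const
    · exact continuousOn_const.mul ((continuousOn_norm_sub_rpow _ 0).mono hD0)
    · exact continuousOn_const.mul ((continuousOn_norm_sub_rpow _ y).mono hDy)

section Shells

variable {X : Type*} [TopologicalSpace X] {f g : X → ℝ}

lemma isOpen_shell (hf : Continuous f) (hg : Continuous g) (a b : ℝ) :
    IsOpen {x | a < f x ∧ g x < b} :=
  (isOpen_lt continuous_const hf).inter (isOpen_lt hg continuous_const)

lemma closure_shell_subset (hf : Continuous f) (hg : Continuous g) (a b : ℝ) :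
    closure {x | a < f x ∧ g x < b} ⊆ {x | a ≤ f x ∧ g x ≤ b} :=
  closure_minimal (fun _ hx => ⟨hx.1.le, hx.2.le⟩)
    ((isClosed_le continuous_const hf).inter (isClosed_le hg continuous_const))

lemma frontier_shell (hf : Continuous f) (hg : Continuous g) {a b : ℝ} {x : X}
    (hx : x ∈ frontier {x | a < f x ∧ g x < b}) : (f x = a ∨ g x = b) ∧ a ≤ f x ∧ g x ≤ b := by
  rw [(isOpen_shell hf hg a b).frontier_eq] at hx
  have h1 := closure_shell_subset hf hg a b hx.1
  refine ⟨?_, h1⟩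
  by_contra! h
  exact hx.2 ⟨lt_of_le_of_ne h1.1 h.1.symm, lt_of_le_of_ne h1.2 h.2⟩

end Shells

lemma continuous_norm_sub_const (y : 𝔼) : Continuous fun x => ‖x - y‖ := by fun_prop

lemma closure_annulus_subset (y : 𝔼) (r s : ℝ) :
    closure {x | r < ‖x - y‖ ∧ ‖x - y‖ < s} ⊆ {x | r ≤ ‖x - y‖ ∧ ‖x - y‖ ≤ s} :=
  closure_shell_subset (continuous_norm_sub_const y) (continuous_norm_sub_const y) r s

lemma isOpen_annulus (y : 𝔼) (r s : ℝ) : IsOpen {x | r < ‖x - y‖ ∧ ‖x - y‖ < s} :=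
  isOpen_shell (continuous_norm_sub_const y) (continuous_norm_sub_const y) r s

lemma isBounded_annulus (y : 𝔼) (r s : ℝ) :
    Bornology.IsBounded {x | r < ‖x - y‖ ∧ ‖x - y‖ < s} :=
  isBounded_ball.subset fun x hx => by rw [mem_ball, dist_eq_norm]; exact hx.2

lemma frontier_annulus {y x : 𝔼} {r s : ℝ}
    (hx : x ∈ frontier {x | r < ‖x - y‖ ∧ ‖x - y‖ < s}) :
    (‖x - y‖ = r ∨ ‖x - y‖ = s) ∧ r ≤ ‖x - y‖ ∧ ‖x - y‖ ≤ s :=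
  frontier_shell (continuous_norm_sub_const y) (continuous_norm_sub_const y) hx

lemma exists_small_coeff {q s σ ρ m : ℝ} (hq : 0 < q) (hσ : 0 < σ) (hρ : 0 < ρ) (hm : 0 < m)
    (hs : 0 ≤ s) : ∃ κ : ℝ, 0 < κ ∧ κ * ρ ^ (-q) ≤ σ ∧ (0 < s → κ * q * ρ ^ (-q - 1) < s * m) := by
  have h1 : 0 < ρ ^ (-q) := by positivity
  have h2 : 0 < q * ρ ^ (-q - 1) := by positivity
  rcases hs.eq_or_lt with h | h
  · exact ⟨σ / ρ ^ (-q), by positivity, by rw [div_mul_cancel₀ _ h1.ne'], fun h' => by linarith⟩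
  · refine ⟨min (σ / ρ ^ (-q)) (s * m / (q * ρ ^ (-q - 1)) / 2), by positivity, ?_, fun _ => ?_⟩
    · rw [← le_div_iff₀ h1]; exact min_le_left _ _
    · rw [mul_assoc, ← lt_div_iff₀ h2]
      refine (min_le_right _ _).trans_lt ?_
      have : 0 < s * m / (q * ρ ^ (-q - 1)) := by positivity
      linarith

lemma exists_gain_ball (hd : 2 ≤ d) {p : ℝ} (hp : d < p) {a σ ρ : ℝ} (ha : 0 ≤ a) (hσ : 0 < σ)
    (hρ : 0 < ρ) : ∃ ε > 0, ∃ σ' > 0, ∀ (y : 𝔼) (U : 𝔼 → ℝ), ‖y‖ = 1 →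
      IsPHarmonic p {x | 1 / 4 < ‖x‖} U →
      (∀ z, 1 / 4 < ‖z‖ → ‖z‖ ≤ 2 → a * ‖z‖ ^ ((p - d) / (p - 1)) - ε ≤ U z) →
      (∀ z ∈ ball y ρ, a * ‖z‖ ^ ((p - d) / (p - 1)) + σ ≤ U z) →
      ∀ z ∈ ball y (1 / 3), a * ‖z‖ ^ ((p - d) / (p - 1)) + σ' ≤ U z := by
  have hd' : (2 : ℝ) ≤ d := by exact_mod_cast hd
  set α := (p - d) / (p - 1) with hα
  have hp1 : 0 < p - 1 := by linarith
  have hα0 : 0 < α := div_pos (by linarith) hp1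
  have hα1 : α < 1 := by rw [hα, div_lt_one hp1]; linarith
  set q : ℝ := d + p - 4 with hq
  have hq0 : 0 < q := by linarith
  set r := min (ρ / 2) (1 / 4) with hr
  have hr0 : 0 < r := by positivity
  have hrρ : r < ρ := (min_le_left _ _).trans_lt (by linarith)
  have hr4 : r ≤ 1 / 4 := min_le_right _ _
  obtain ⟨κ, hκ0, hκσ, hκv⟩ := exists_small_coeff hq0 hσ hr0 (m := (2 : ℝ) ^ (α - 1))
    (by positivity) (s := a * α) (by positivity)
  have h23 : (1 / 2 : ℝ) ^ (-q) < (1 / 3 : ℝ) ^ (-q) :=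
    Real.rpow_lt_rpow_of_neg (by norm_num) (by norm_num) (by linarith)
  set ε := κ * ((1 / 3 : ℝ) ^ (-q) - (1 / 2 : ℝ) ^ (-q)) / 2 with hε
  have hε0 : 0 < ε := by have := sub_pos.2 h23; positivity
  refine ⟨ε, hε0, min σ ε, by positivity, fun y U hy hU hUε hUσ z hz => ?_⟩
  rw [mem_ball, dist_eq_norm] at hz
  rcases le_or_gt ‖z - y‖ r with hzr | hzr
  · have := hUσ z (by rw [mem_ball, dist_eq_norm]; linarith)
    have := min_le_left σ ε
    linarith
  set D : Set 𝔼 := {x | r < ‖x - y‖ ∧ ‖x - y‖ < 1 / 2} with hD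
  have hcl := closure_annulus_subset y r (1 / 2)
  have hnorm : ∀ x ∈ closure D, 1 / 2 ≤ ‖x‖ ∧ ‖x‖ ≤ 3 / 2 := by
    intro x hx
    have h1 := (hcl hx).2
    have h2 := abs_norm_sub_norm_le x y
    rw [hy] at h2
    have := abs_le.1 (h2.trans h1)
    constructor <;> linarith
  have key := hU.barrier_le hd hp (isOpen_lt continuous_const continuous_norm)
    (isOpen_annulus y r (1 / 2)) (isBounded_annulus y r (1 / 2))
    (fun x hx => by have := hnorm x hx; exact show 1 / 4 < ‖x‖ by linarith) (y := y)
    (fun h => by have := (hcl h).1; simp at this; linarith)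
    (fun h => by have := hnorm 0 h; simp at this; linarith) (a := a)
    (b := -κ * (1 / 2 : ℝ) ^ (-q) - ε) (c := κ) ha hκ0 ?_ ?_ (x := z) ⟨hzr, by linarith⟩
  · simp only [sub_zero] at key
    have h0 : 0 < ‖z - y‖ := by linarith
    have h1 : (1 / 3 : ℝ) ^ (-q) ≤ ‖z - y‖ ^ (-q) :=
      Real.rpow_le_rpow_of_nonpos h0 hz.le (by linarith)
    have h2 := mul_le_mul_of_nonneg_left h1 hκ0.le
    have := min_le_right σ ε
    have : κ * (1 / 3 : ℝ) ^ (-q) - κ * (1 / 2 : ℝ) ^ (-q) = 2 * ε := by rw [hε]; ring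
    linarith
  · intro x hx h0
    have hxc := hnorm x (subset_closure hx)
    have hx0 : 0 < ‖x‖ := by linarith
    have hxy : 0 < ‖x - y‖ := hr0.trans hx.1
    rw [sub_zero, ← hα, ← hq, mul_neg, neg_mul, neg_smul, add_neg_eq_zero] at h0
    have h1 := congrArg norm h0
    rw [norm_smul, norm_smul, Real.norm_of_nonneg (by positivity),
      Real.norm_of_nonneg (by positivity), mul_assoc, mul_assoc (κ * q),
      ← Real.rpow_add_one hx0.ne',
      ← Real.rpow_add_one hxy.ne'] at h1
    rcases (show 0 ≤ a * α by positivity).eq_or_lt with h | h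
    · rw [← h, zero_mul] at h1
      have : 0 < κ * q * ‖x - y‖ ^ (-q - 2 + 1) := by positivity
      linarith
    · have h2 := hκv h
      have h3 : (2 : ℝ) ^ (α - 1) ≤ ‖x‖ ^ (α - 2 + 1) := by
        rw [show α - 2 + 1 = α - 1 by ring]
        exact Real.rpow_le_rpow_of_nonpos hx0 (by linarith) (by linarith)
      have h4 : ‖x - y‖ ^ (-q - 2 + 1) ≤ r ^ (-q - 1) := by
        rw [show -q - 2 + 1 = -q - 1 by ring]
        exact Real.rpow_le_rpow_of_nonpos hr0 hx.1.le (by linarith)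
      have h5 := mul_le_mul_of_nonneg_left h3 h.le
      have h6 := mul_le_mul_of_nonneg_left h4 (show 0 ≤ κ * q by positivity)
      linarith
  · intro x hx
    rw [sub_zero]
    have hxc := hnorm x (frontier_subset_closure hx)
    rcases (frontier_annulus hx).1 with h | h
    · have := hUσ x (by rw [mem_ball, dist_eq_norm, h]; exact hrρ)
      rw [h]
      have : 0 < κ * (1 / 2 : ℝ) ^ (-q) := by positivity
      linarith
    · have := hUε x (by linarith) (by linarith)
      rw [h]; linarith

lemma exponent_pos {p : ℝ} (hd : 2 ≤ d) (hp : d < p) : 0 < (p - d) / (p - 1) := by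
  have hd' : (2 : ℝ) ≤ d := by exact_mod_cast hd
  exact div_pos (by linarith) (by linarith)

/-- A one-sided Harnack inequality: a nonnegative `p`-harmonic function, `p > d`, lies above a cone
centred at an arbitrary point. -/
lemma IsPHarmonic.cone_le (hd : 2 ≤ d) {p : ℝ} (hp : d < p) {Ω : Set 𝔼} {U : 𝔼 → ℝ}
    (hΩ : IsOpen Ω) (hU : IsPHarmonic p Ω U) {x : 𝔼} {r : ℝ} (hr : 0 < r)
    (hx : closedBall x r ⊆ Ω) (h0 : ∀ z ∈ closedBall x r, 0 ≤ U z) {z : 𝔼} (hz : ‖z - x‖ < r) :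
    U x * (1 - (‖z - x‖ / r) ^ ((p - d) / (p - 1))) ≤ U z := by
  have hα0 := exponent_pos hd hp
  set α := (p - d) / (p - 1) with hα
  rcases eq_or_ne z x with rfl | hzx
  · simp [Real.zero_rpow hα0.ne']
  have hz0 : 0 < ‖z - x‖ := norm_pos_iff.2 (sub_ne_zero.2 hzx)
  have hcl := closure_annulus_subset x 0 r
  have hball : ∀ y : 𝔼, ‖y - x‖ ≤ r → y ∈ closedBall x r := fun y hy => by
    rwa [mem_closedBall, dist_eq_norm]
  have key := hU.radial_le hd hp.le hΩ (isOpen_annulus x 0 r) (isBounded_annulus x 0 r)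
    (fun y hy => hx (hball y (hcl hy).2)) (z := x) (fun h => by simpa using h.1) (A := U x)
    (c := -(U x / r ^ α)) ?_ ?_ (x := z) ⟨hz0, hz⟩
  · simp only [radialGauge, hp, if_true, ← hα] at key
    rw [Real.div_rpow hz0.le hr.le]
    refine le_trans (le_of_eq ?_) key
    ring
  · simp only [radialGauge, hp, if_true, ← hα]
    exact (continuous_const.add (continuous_const.mul
      ((continuous_id.sub continuous_const).norm.rpow_const fun _ => Or.inr hα0.le))).continuousOn
  · intro y hy
    have h1 := frontier_annulus hy
    simp only [radialGauge, hp, if_true, ← hα]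
    rcases h1.1 with h | h
    · have : y = x := sub_eq_zero.1 (norm_eq_zero.1 h)
      rw [this]; simp [Real.zero_rpow hα0.ne']
    · have : 0 < r ^ α := by positivity
      have h2 := h0 y (hball y h1.2.2)
      have : U x + -(U x / r ^ α) * ‖y - x‖ ^ α = 0 := by rw [h]; field_simp; ring
      linarith

/-- Quantitative strong comparison principle on the unit sphere, for `p > d`. -/
lemma exists_gain_sphere (hd : 2 ≤ d) {p : ℝ} (hp : d < p) {a δ : ℝ} (ha : 0 ≤ a) (hδ : 0 < δ) :
    ∃ η > 0, ∀ U : 𝔼 → ℝ, IsPHarmonic p {x | 1 / 4 < ‖x‖} U →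
      (∀ z, 1 / 4 < ‖z‖ → ‖z‖ ≤ 2 → 0 ≤ U z ∧ a * ‖z‖ ^ ((p - d) / (p - 1)) - η ≤ U z) →
      (∃ x, ‖x‖ = 1 ∧ a + δ ≤ U x) → ∀ y, ‖y‖ = 1 → a + η ≤ U y := by
  have hα0 := exponent_pos hd hp
  set α := (p - d) / (p - 1) with hα
  by_contra! hcon
  have hη : ∀ k : ℕ, (0 : ℝ) < 1 / (k + 1) := fun k => by positivity
  choose U hU hU0 hx y hy hyU using fun k : ℕ => hcon (1 / (k + 1)) (hη k)
  choose x hx1 hxU using hx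
  set l : Ultrafilter ℕ := hyperfilter ℕ with hl
  have hlt : Tendsto (fun k : ℕ => 1 / ((k : ℝ) + 1)) l (𝓝 0) :=
    tendsto_one_div_add_atTop_nhds_zero_nat.mono_left Nat.hyperfilter_le_atTop
  have hlim : ∀ f : ℕ → 𝔼, (∀ k, ‖f k‖ = 1) → ∃ x, ‖x‖ = 1 ∧ Tendsto f l (𝓝 x) := by
    intro f hf
    obtain ⟨x, hx, hle⟩ := (isCompact_sphere (0 : 𝔼) 1).ultrafilter_le_nhds (l.map f) (by
      rw [le_principal_iff]
      exact Filter.mem_map.2 (Filter.Eventually.of_forall fun k => by simp [hf k]))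
    exact ⟨x, by simpa using hx, hle⟩
  obtain ⟨x₀, hx₀, hxl⟩ := hlim x hx1
  obtain ⟨y₀, hy₀, hyl⟩ := hlim y hy
  set Z : Set 𝔼 := {y | ‖y‖ = 1 ∧ ∃ σ > 0, ∃ ρ > 0, ∀ᶠ k in l, ∀ z ∈ ball y ρ,
    a * ‖z‖ ^ α + σ ≤ U k z} with hZ
  have hopen : IsOpen {x : 𝔼 | 1 / 4 < ‖x‖} := isOpen_lt continuous_const continuous_norm
  have hx₀Z : x₀ ∈ Z := by
    refine ⟨hx₀, δ / 2, by positivity, ?_⟩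
    have hf : Continuous fun w : 𝔼 × 𝔼 =>
        (a + δ) * (1 - (‖w.1 - w.2‖ / (1 / 2)) ^ α) - a * ‖w.1‖ ^ α := by
      refine Continuous.sub (continuous_const.mul (continuous_const.sub
        (Continuous.rpow_const (by fun_prop) fun _ => Or.inr hα0.le)))
        (continuous_const.mul (Continuous.rpow_const (by fun_prop) fun _ => Or.inr hα0.le))
    have h1 : ∀ᶠ w : 𝔼 × 𝔼 in 𝓝 (x₀, x₀), δ / 2 <
        (a + δ) * (1 - (‖w.1 - w.2‖ / (1 / 2)) ^ α) - a * ‖w.1‖ ^ α := by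
      refine hf.continuousAt.eventually_const_lt ?_
      simp [hx₀, Real.zero_rpow hα0.ne', hδ]
    obtain ⟨ρ, hρ, hρw⟩ := Metric.eventually_nhds_iff_ball.1 h1
    refine ⟨min ρ (1 / 4), by positivity, ?_⟩
    filter_upwards [hxl (ball_mem_nhds x₀ (show 0 < min ρ (1 / 4) by positivity))] with k hk z hz
    have hk' : dist (x k) x₀ < min ρ (1 / 4) := hk
    have hz' : dist z x₀ < min ρ (1 / 4) := hz
    have h2 := hρw (z, x k) (by
      rw [mem_ball, Prod.dist_eq]
      exact max_lt (hz'.trans_le (min_le_left _ _)) (hk'.trans_le (min_le_left _ _)))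
    have hzk : ‖z - x k‖ < 1 / 2 := by
      rw [← dist_eq_norm]
      have := dist_triangle_right z (x k) x₀
      have := min_le_right ρ (1 / 4)
      linarith
    have hb : ∀ w ∈ closedBall (x k) (1 / 2), 1 / 4 < ‖w‖ ∧ ‖w‖ ≤ 2 := by
      intro w hw
      rw [mem_closedBall, dist_eq_norm] at hw
      have := abs_le.1 ((abs_norm_sub_norm_le w (x k)).trans hw)
      rw [hx1 k] at this
      constructor <;> linarith
    have h3 := (hU k).cone_le hd hp hopen (x := x k) (r := 1 / 2) (by norm_num)
      (fun w hw => (hb w hw).1) (fun w hw => (hU0 k w (hb w hw).1 (hb w hw).2).1) hzk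
    have h4 : 0 ≤ 1 - (‖z - x k‖ / (1 / 2)) ^ α := by
      rw [sub_nonneg]
      exact Real.rpow_le_one (by positivity) (by rw [div_le_one (by norm_num)]; exact hzk.le) hα0.le
    have h5 := mul_le_mul_of_nonneg_right (hxU k) h4
    simp only at h2
    linarith
  have hstep : ∀ w ∈ Z, ∀ w', ‖w'‖ = 1 → dist w' w < 1 / 3 → w' ∈ Z := by
    rintro w ⟨hw, σ, hσ, ρ, hρ, hwk⟩ w' hw' hdist
    obtain ⟨ε, hε, σ', hσ', H⟩ := exists_gain_ball hd hp ha hσ hρ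
    refine ⟨hw', σ', hσ', 1 / 3 - dist w' w, by linarith, ?_⟩
    filter_upwards [hwk, hlt.eventually_lt_const hε] with k hk hkε z hz
    refine H w (U k) hw (hU k) (fun z h1 h2 => ?_) hk z ?_
    · have := (hU0 k z h1 h2).2
      linarith
    · rw [mem_ball] at hz ⊢
      have := dist_triangle z w' w
      linarith
  have hsub : sphere (0 : 𝔼) 1 ⊆ ⋃ w ∈ Z, ball w (1 / 6) := by
    refine IsPreconnected.subset_of_closure_inter_subset ?_
      (isOpen_biUnion fun _ _ => isOpen_ball) ?_ ?_
    · refine isPreconnected_sphere ?_ _ _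
      rw [rank_eq_card_basis (EuclideanSpace.basisFun (Fin d) ℝ).toBasis]
      simp only [Fintype.card_fin]
      exact_mod_cast hd
    · exact ⟨x₀, by simpa using hx₀, mem_biUnion hx₀Z (mem_ball_self (by norm_num))⟩
    · rintro w ⟨hw, hw1⟩
      obtain ⟨w₁, hw₁, hd1⟩ := Metric.mem_closure_iff.1 hw (1 / 6) (by norm_num)
      obtain ⟨w₂, hw₂, hd2⟩ := mem_iUnion₂.1 hw₁
      rw [mem_ball] at hd2
      have := dist_triangle w w₁ w₂
      exact mem_biUnion (hstep w₂ hw₂ w (by simpa using hw1) (by linarith))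
        (mem_ball_self (by norm_num))
  obtain ⟨w, hw, hwy⟩ := mem_iUnion₂.1 (hsub (show y₀ ∈ sphere (0 : 𝔼) 1 by simpa using hy₀))
  rw [mem_ball] at hwy
  obtain ⟨-, σ, hσ, ρ, hρ, hev⟩ := hstep w hw y₀ hy₀ (by linarith)
  have := (hev.and ((hlt.eventually_lt_const hσ).and (hyl (ball_mem_nhds y₀ hρ)))).exists
  obtain ⟨k, h1, h2, h3⟩ := this
  have h4 := h1 (y k) h3
  have h5 := hyU k
  rw [hy k, Real.one_rpow] at h4
  linarith

section Gauge

lemma continuousOn_radialGauge (d : ℕ) (p : ℝ) : ContinuousOn (radialGauge d p) (Ioi 0) := by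
  by_cases h : (d : ℝ) < p
  · have : radialGauge d p = fun r => r ^ ((p - d) / (p - 1)) := by
      funext r; simp [radialGauge, h]
    rw [this]
    exact continuousOn_id.rpow_const fun x hx => Or.inl (ne_of_gt hx)
  · have : radialGauge d p = Real.log := by funext r; simp [radialGauge, h]
    rw [this]
    exact Real.continuousOn_log.mono fun x hx => ne_of_gt hx

lemma radialGauge_strictMonoOn (hd : 2 ≤ d) {p : ℝ} (_hp : d ≤ p) :
    StrictMonoOn (radialGauge d p) (Ioi 0) := by
  intro x hx y _ hxy
  by_cases h : (d : ℝ) < p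
  · simp only [radialGauge, h, if_true]
    exact Real.rpow_lt_rpow (le_of_lt hx) hxy (exponent_pos hd h)
  · simp only [radialGauge, h, if_false]
    exact Real.log_lt_log hx hxy

lemma tendsto_radialGauge (hd : 2 ≤ d) (p : ℝ) : Tendsto (radialGauge d p) atTop atTop := by
  by_cases h : (d : ℝ) < p
  · have : radialGauge d p = fun r => r ^ ((p - d) / (p - 1)) := by
      funext r; simp [radialGauge, h]
    rw [this]
    exact tendsto_rpow_atTop (exponent_pos hd h)
  · have : radialGauge d p = Real.log := by funext r; simp [radialGauge, h]
    rw [this]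
    exact Real.tendsto_log_atTop

end Gauge

/-- The radial `p`-harmonic function vanishing on the sphere of radius `r`. -/
def radialSol (p r : ℝ) (x : 𝔼) : ℝ := radialGauge d p ‖x‖ - radialGauge d p r

lemma radialSol_nonneg (hd : 2 ≤ d) {p r : ℝ} (hp : d ≤ p) (hr : 0 < r) {x : 𝔼} (hx : r ≤ ‖x‖) :
    0 ≤ radialSol p r x :=
  sub_nonneg.2 ((radialGauge_strictMonoOn hd hp).monotoneOn hr (hr.trans_le hx) hx)

lemma radialSol_pos (hd : 2 ≤ d) {p r : ℝ} (hp : d ≤ p) (hr : 0 < r) {x : 𝔼} (hx : r < ‖x‖) :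
    0 < radialSol p r x :=
  sub_pos.2 (radialGauge_strictMonoOn hd hp hr (hr.trans hx) hx)

lemma radialSol_eq_zero {p r : ℝ} {x : 𝔼} (hx : ‖x‖ = r) : radialSol p r x = 0 := by
  rw [radialSol, hx, sub_self]

lemma radialSol_eventually_lt (hd : 2 ≤ d) (p r K : ℝ) :
    ∃ t₀ : ℝ, ∀ x : 𝔼, t₀ ≤ ‖x‖ → K < radialSol p r x := by
  obtain ⟨t₀, h⟩ := eventually_atTop.1 ((tendsto_radialGauge hd p).eventually_gt_atTop
    (K + radialGauge d p r))
  exact ⟨t₀, fun x hx => by have := h _ hx; simp only [radialSol]; linarith⟩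

lemma exists_euclidean_norm_eq (hd : 2 ≤ d) {t : ℝ} (ht : 0 ≤ t) : ∃ x : 𝔼, ‖x‖ = t :=
  ⟨EuclideanSpace.single ⟨0, by omega⟩ t, by simp [abs_of_nonneg ht]⟩

section Shell

variable {p R₀ r a b A c B : ℝ} {u f g : EuclideanSpace ℝ (Fin d) → ℝ}

lemma isOpen_exterior (R : ℝ) : IsOpen {x : 𝔼 | R < ‖x‖} :=
  isOpen_lt continuous_const continuous_norm

lemma IsPHarmonic.radialSol_le_of_shell (hd : 2 ≤ d) (hp : d ≤ p) (hR₀ : 0 < R₀) (hr : R₀ < r)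
    (hu : IsPHarmonic p {x | R₀ < ‖x‖} u) (hf : Continuous f) (hg : Continuous g)
    (hfa : ∀ x, a ≤ f x → r ≤ ‖x‖) (hgb : ∀ x, g x ≤ b → ‖x‖ ≤ B)
    (h : ∀ x, f x = a ∨ g x = b → a ≤ f x → g x ≤ b → A + c * radialSol p r x ≤ u x)
    {x : 𝔼} (hxa : a ≤ f x) (hxb : g x ≤ b) : A + c * radialSol p r x ≤ u x := by
  by_cases hx : f x = a ∨ g x = b
  · exact h x hx hxa hxb
  push Not at hx
  have hcl := closure_shell_subset hf hg a b
  have e : ∀ y : 𝔼, A + c * radialSol p r y =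
      (A - c * radialGauge d p r) + c * radialGauge d p ‖y - 0‖ := by
    intro y; rw [sub_zero, radialSol]; ring
  rw [e]
  refine hu.radial_le hd hp (isOpen_exterior R₀) (isOpen_shell hf hg a b) ?_ ?_ ?_ ?_ ?_
    ⟨lt_of_le_of_ne hxa hx.1.symm, lt_of_le_of_ne hxb hx.2⟩
  · exact isBounded_closedBall.subset fun y hy => mem_closedBall_zero_iff.2 (hgb y hy.2.le)
  · exact fun y hy => hr.trans_le (hfa y (hcl hy).1)
  · intro h0
    have := hfa 0 h0.1.le
    rw [norm_zero] at this; linarith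
  · refine continuousOn_const.add (continuousOn_const.mul ?_)
    refine (continuousOn_radialGauge d p).comp (by fun_prop) fun y hy => ?_
    have := hfa y (hcl hy).1
    rw [sub_zero]
    exact show 0 < ‖y‖ by linarith
  · intro y hy
    have := frontier_shell hf hg hy
    rw [← e]
    exact h y this.1 this.2.1 this.2.2

lemma IsPHarmonic.le_radialSol_of_shell (hd : 2 ≤ d) (hp : d ≤ p) (hR₀ : 0 < R₀) (hr : R₀ < r)
    (hu : IsPHarmonic p {x | R₀ < ‖x‖} u) (hf : Continuous f) (hg : Continuous g)
    (hfa : ∀ x, a ≤ f x → r ≤ ‖x‖) (hgb : ∀ x, g x ≤ b → ‖x‖ ≤ B)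
    (h : ∀ x, f x = a ∨ g x = b → a ≤ f x → g x ≤ b → u x ≤ A + c * radialSol p r x)
    {x : 𝔼} (hxa : a ≤ f x) (hxb : g x ≤ b) : u x ≤ A + c * radialSol p r x := by
  have := (hu.neg (isOpen_exterior R₀)).radialSol_le_of_shell hd hp hR₀ hr hf hg hfa hgb
    (A := -A) (c := -c) (fun y h1 h2 h3 => by have := h y h1 h2 h3; linarith) hxa hxb
  linarith

/-- A lower bound on a level set of `N` persists outside it, for functions bounded below. -/
lemma IsPHarmonic.le_of_le_level (hd : 2 ≤ d) (hp : d ≤ p) (hR₀ : 0 < R₀) (hr : R₀ < r)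
    (hu : IsPHarmonic p {x | R₀ < ‖x‖} u) {N : 𝔼 → ℝ} (hN : Continuous N) (hN1 : ∀ x, N x ≤ ‖x‖)
    {m s K : ℝ} (hs : r ≤ s) (hK : ∀ x, r ≤ ‖x‖ → K ≤ u x) (hm : ∀ x, N x = s → m ≤ u x) {x : 𝔼}
    (hx : s ≤ N x) : m ≤ u x := by
  have hT : ∀ y, s ≤ N y → 0 ≤ radialSol p r y := fun y hy =>
    radialSol_nonneg hd hp (hR₀.trans hr) (hs.trans (hy.trans (hN1 y)))
  have key : ∀ δ > 0, m ≤ u x + δ * radialSol p r x := by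
    intro δ hδ
    obtain ⟨t₀, ht₀⟩ := radialSol_eventually_lt (d := d) hd p r ((m - K) / δ)
    have := hu.radialSol_le_of_shell hd hp hR₀ hr hN continuous_norm (a := s)
      (b := max t₀ ‖x‖) (A := m) (c := -δ) (fun y hy => hs.trans (hy.trans (hN1 y)))
      (fun y hy => hy) (fun y h1 h2 h3 => ?_) hx (le_max_right _ _)
    · linarith
    have hTy := hT y h2
    rcases h1 with h1 | h1
    · have := hm y h1
      nlinarith
    · have h4 := ht₀ y (by rw [h1]; exact le_max_left _ _)
      rw [div_lt_iff₀ hδ] at h4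
      have := hK y (hs.trans (h2.trans (hN1 y)))
      linarith
  refine le_of_forall_pos_le_add fun ε hε => ?_
  have h1 := hT x hx
  refine (key (ε / (radialSol p r x + 1)) (by positivity)).trans ?_
  gcongr
  rw [div_mul_eq_mul_div, div_le_iff₀ (by positivity)]
  nlinarith

lemma IsPHarmonic.le_of_level_le (hd : 2 ≤ d) (hp : d ≤ p) (hR₀ : 0 < R₀) (hr : R₀ < r)
    (hu : IsPHarmonic p {x | R₀ < ‖x‖} u) {N : 𝔼 → ℝ} (hN : Continuous N) (hN1 : ∀ x, N x ≤ ‖x‖)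
    {m s K : ℝ} (hs : r ≤ s) (hK : ∀ x, r ≤ ‖x‖ → u x ≤ K) (hm : ∀ x, N x = s → u x ≤ m) {x : 𝔼}
    (hx : s ≤ N x) : u x ≤ m := by
  have := (hu.neg (isOpen_exterior R₀)).le_of_le_level hd hp hR₀ hr hN hN1 (m := -m) (K := -K) hs
    (fun y hy => neg_le_neg (hK y hy)) (fun y hy => neg_le_neg (hm y hy)) hx
  linarith

end Shell

section Dichotomy

variable {p R₀ r : ℝ} {u N : EuclideanSpace ℝ (Fin d) → ℝ}

/-- The optimal constant in the lower bound of a positive exterior `p`-harmonic function by a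
multiple of the fundamental solution. -/
lemma IsPHarmonic.exists_optimal_slope (hd : 2 ≤ d) (hp : d ≤ p) (hR₀ : 0 < R₀) (hr : R₀ < r)
    (hu : IsPHarmonic p {x | R₀ < ‖x‖} u) (hpos : ∀ x, R₀ < ‖x‖ → 0 < u x) :
    ∃ a, 0 ≤ a ∧ (∀ x, r ≤ ‖x‖ → a * radialSol p r x ≤ u x) ∧
      ∀ c > a, ∀ S, ∃ x, S < ‖x‖ ∧ u x < c * radialSol p r x := by
  have hr0 : 0 < r := hR₀.trans hr
  set C : Set ℝ := {c | ∀ x, r ≤ ‖x‖ → c * radialSol p r x ≤ u x} with hC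
  have h0 : (0 : ℝ) ∈ C := fun x hx => by
    rw [zero_mul]; exact (hpos x (hr.trans_le hx)).le
  obtain ⟨x₁, hx₁⟩ := exists_euclidean_norm_eq (d := d) hd (show 0 ≤ r + 1 by linarith)
  have hbdd : BddAbove C := by
    refine ⟨u x₁ / radialSol p r x₁, fun c hc => ?_⟩
    rw [le_div_iff₀ (radialSol_pos hd hp hr0 (by linarith))]
    exact hc x₁ (by linarith)
  have ha : sSup C ∈ C := by
    intro x hx
    rcases hx.eq_or_lt with h | h
    · rw [radialSol_eq_zero h.symm, mul_zero]; exact (hpos x (hr.trans_le hx)).le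
    · have hT := radialSol_pos hd hp hr0 h
      rw [← le_div_iff₀ hT]
      exact csSup_le ⟨0, h0⟩ fun c hc => by rw [le_div_iff₀ hT]; exact hc x hx
  refine ⟨sSup C, le_csSup hbdd h0, ha, fun c hc S => ?_⟩
  by_contra! hcon
  refine not_le.2 hc (le_csSup hbdd fun x hx => ?_)
  have := hu.radialSol_le_of_shell hd hp hR₀ hr continuous_norm continuous_norm (a := r)
    (b := max (S + 1) ‖x‖) (A := 0) (c := c) (fun y hy => hy) (fun y hy => hy)
    (fun y h1 h2 h3 => ?_) hx (le_max_right _ _)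
  · linarith
  rw [zero_add]
  rcases h1 with h1 | h1
  · rw [radialSol_eq_zero h1, mul_zero]; exact (hpos y (hr.trans_le h2)).le
  · exact hcon y (by rw [h1]; exact (lt_add_one S).trans_le (le_max_left _ _))

/-- If `u` is almost minimal on arbitrarily large level sets of `N` then it is bounded by the
corresponding multiple of the fundamental solution. -/
lemma IsPHarmonic.exists_le_add_radialSol (hd : 2 ≤ d) (hp : d ≤ p) (hR₀ : 0 < R₀) (hr : R₀ < r)
    (hu : IsPHarmonic p {x | R₀ < ‖x‖} u) (hN : Continuous N) {C : ℝ}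
    (hN2 : ∀ x, ‖x‖ ≤ C * N x) (hC : 0 < C) {a : ℝ} 
    (H : ∀ ε > 0, ∀ S, ∃ s > S, ∀ x, N x = s → r ≤ ‖x‖ → u x ≤ (a + ε) * radialSol p r x) :
    ∃ M, 0 ≤ M ∧ ∀ x, r ≤ ‖x‖ → u x ≤ M + a * radialSol p r x := by
  have hr0 : 0 < r := hR₀.trans hr
  have hcont : ContinuousOn u (sphere 0 r) := hu.1.continuousOn.mono fun x hx => by
    rw [mem_sphere_zero_iff_norm] at hx; exact show R₀ < ‖x‖ by linarith
  obtain ⟨M, hM⟩ := (isCompact_sphere (0 : 𝔼) r).bddAbove_image hcont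
  have hM' : ∀ x : 𝔼, ‖x‖ = r → u x ≤ max M 0 := fun x hx =>
    (hM (mem_image_of_mem u (mem_sphere_zero_iff_norm.2 hx))).trans (le_max_left _ _)
  refine ⟨max M 0, le_max_right _ _, fun x hx => ?_⟩
  have hTx := radialSol_nonneg hd hp hr0 hx
  refine le_of_forall_pos_le_add fun ε hε => ?_
  set δ := ε / (radialSol p r x + 1) with hδ
  have hδ0 : 0 < δ := by positivity
  have hδT : δ * radialSol p r x ≤ ε := by
    rw [hδ, div_mul_eq_mul_div, div_le_iff₀ (by positivity)]
    nlinarith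
  obtain ⟨s, hs, hsu⟩ := H δ hδ0 (N x)
  have := hu.le_radialSol_of_shell hd hp hR₀ hr continuous_norm hN (a := r) (b := s)
    (A := max M 0) (c := a + δ) (B := C * s) (fun y hy => hy)
    (fun y hy => (hN2 y).trans (by gcongr)) (fun y h1 h2 h3 => ?_) hx hs.le
  · linarith
  rcases h1 with h1 | h1
  · rw [radialSol_eq_zero h1, mul_zero, add_zero]; exact hM' y h1
  · have := hsu y h1 h2
    have := le_max_right M 0
    linarith

lemma IsPHarmonic.tendsto_div_radialGauge (hd : 2 ≤ d) {a M : ℝ}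
    (h1 : ∀ x : 𝔼, r ≤ ‖x‖ → a * radialSol p r x ≤ u x)
    (h2 : ∀ x : 𝔼, r ≤ ‖x‖ → u x ≤ M + a * radialSol p r x) :
    Tendsto (fun x => u x / radialGauge d p ‖x‖) (Bornology.cobounded 𝔼) (𝓝 a) := by
  have hG : Tendsto (fun x : 𝔼 => radialGauge d p ‖x‖) (Bornology.cobounded 𝔼) atTop :=
    (tendsto_radialGauge hd p).comp tendsto_norm_cobounded_atTop
  have hlim : ∀ K : ℝ, Tendsto (fun x : 𝔼 => K / radialGauge d p ‖x‖ + a)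
      (Bornology.cobounded 𝔼) (𝓝 a) := by
    intro K
    simpa using (hG.const_div_atTop K).add_const a
  refine tendsto_of_tendsto_of_tendsto_of_le_of_le' (hlim (-(a * radialGauge d p r)))
    (hlim (M - a * radialGauge d p r)) ?_ ?_
  · filter_upwards [hG.eventually_gt_atTop 0,
      tendsto_norm_cobounded_atTop.eventually_ge_atTop r] with x hx hxr
    have := h1 x hxr
    rw [div_add' _ _ _ hx.ne', div_le_div_iff_of_pos_right hx]
    rw [radialSol] at this; linarith
  · filter_upwards [hG.eventually_gt_atTop 0,
      tendsto_norm_cobounded_atTop.eventually_ge_atTop r] with x hx hxr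
    have := h2 x hxr
    rw [div_add' _ _ _ hx.ne', div_le_div_iff_of_pos_right hx]
    rw [radialSol] at this; linarith

lemma IsPHarmonic.exists_tendsto (hd : 2 ≤ d) (hp : d ≤ p) (hR₀ : 0 < R₀) (hr : R₀ < r)
    (hu : IsPHarmonic p {x | R₀ < ‖x‖} u) (hpos : ∀ x, R₀ < ‖x‖ → 0 < u x) (hN : Continuous N)
    {C : ℝ} (hN1 : ∀ x, N x ≤ ‖x‖) (hN2 : ∀ x, ‖x‖ ≤ C * N x) (hC : 0 < C) {M : ℝ}
    (hM : ∀ x, r ≤ ‖x‖ → u x ≤ M)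
    (H : ∀ ε > 0, ∀ S, ∃ s > S, ∃ c, ∀ x, N x = s → r ≤ ‖x‖ → c ≤ u x ∧ u x ≤ c + ε) :
    ∃ c, 0 < c ∧ Tendsto u (Bornology.cobounded 𝔼) (𝓝 c) := by
  have hr0 : 0 < r := hR₀.trans hr
  have : NeZero d := ⟨by omega⟩
  have hpos' : ∀ x, r ≤ ‖x‖ → 0 ≤ u x := fun x hx => (hpos x (hr.trans_le hx)).le
  have hlarge : ∀ s, {x | s ≤ N x} ∈ Bornology.cobounded 𝔼 := by
    intro s
    filter_upwards [tendsto_norm_cobounded_atTop.eventually_ge_atTop (C * s)] with x hx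
    exact le_of_mul_le_mul_left (hx.trans (hN2 x)) hC
  have hcauchy : Cauchy (map u (Bornology.cobounded 𝔼)) := by
    rw [Metric.cauchy_iff]
    refine ⟨inferInstance, fun ε hε => ?_⟩
    obtain ⟨s, hs, c, hc⟩ := H (ε / 2) (by positivity) r
    refine ⟨Icc c (c + ε / 2), ?_, fun x hx y hy => ?_⟩
    · rw [mem_map]
      filter_upwards [hlarge s] with x hx
      have hsN : ∀ y, N y = s → r ≤ ‖y‖ := fun y hy => by have := hN1 y; linarith
      exact ⟨hu.le_of_le_level hd hp hR₀ hr hN hN1 hs.le hpos'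
          (fun y hy => (hc y hy (hsN y hy)).1) hx,
        hu.le_of_level_le hd hp hR₀ hr hN hN1 hs.le hM (fun y hy => (hc y hy (hsN y hy)).2) hx⟩
    · rw [Real.dist_eq, abs_lt]
      constructor <;> linarith [hx.1, hx.2, hy.1, hy.2]
  obtain ⟨c, hc⟩ := CompleteSpace.complete hcauchy
  refine ⟨c, ?_, hc⟩
  have hcont : ContinuousOn u (sphere 0 r) := hu.1.continuousOn.mono fun x hx => by
    rw [mem_sphere_zero_iff_norm] at hx; exact show R₀ < ‖x‖ by linarith
  obtain ⟨x₀, hx₀⟩ := exists_euclidean_norm_eq (d := d) hd hr0.le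
  obtain ⟨x₁, hx₁, hmin⟩ := (isCompact_sphere (0 : 𝔼) r).exists_isMinOn
    ⟨x₀, mem_sphere_zero_iff_norm.2 hx₀⟩ hcont
  rw [mem_sphere_zero_iff_norm] at hx₁
  refine (hpos x₁ (by linarith)).trans_le (ge_of_tendsto hc ?_)
  filter_upwards [tendsto_norm_cobounded_atTop.eventually_ge_atTop r] with x hx
  exact hu.le_of_le_level hd hp hR₀ hr continuous_norm (fun _ => le_rfl) le_rfl hpos'
    (fun y hy => hmin (mem_sphere_zero_iff_norm.2 hy)) hx

/-- The dichotomy, reduced to asymptotic constancy on large level sets of `N`. -/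
lemma IsPHarmonic.dichotomy (hd : 2 ≤ d) (hp : d ≤ p) (hR₀ : 0 < R₀) (hr : R₀ < r)
    (hu : IsPHarmonic p {x | R₀ < ‖x‖} u) (hpos : ∀ x, R₀ < ‖x‖ → 0 < u x) (hN : Continuous N)
    {C : ℝ} (hN1 : ∀ x, N x ≤ ‖x‖) (hN2 : ∀ x, ‖x‖ ≤ C * N x) (hC : 0 < C)
    (H₁ : ∀ a, 0 ≤ a → (∀ x, r ≤ ‖x‖ → a * radialSol p r x ≤ u x) →
      (∀ c > a, ∀ S, ∃ x, S < ‖x‖ ∧ u x < c * radialSol p r x) →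
      ∀ ε > 0, ∀ S, ∃ s > S, ∀ x, N x = s → r ≤ ‖x‖ → u x ≤ (a + ε) * radialSol p r x)
    (H₂ : ∀ M, (∀ x, r ≤ ‖x‖ → u x ≤ M) →
      ∀ ε > 0, ∀ S, ∃ s > S, ∃ c, ∀ x, N x = s → r ≤ ‖x‖ → c ≤ u x ∧ u x ≤ c + ε) :
    (∃ c, 0 < c ∧ Tendsto u (Bornology.cobounded 𝔼) (𝓝 c)) ∨
      ∃ c, 0 < c ∧ Tendsto (fun x => u x / radialGauge d p ‖x‖) (Bornology.cobounded 𝔼) (𝓝 c) := by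
  obtain ⟨a, ha, hau, hac⟩ := hu.exists_optimal_slope hd hp hR₀ hr hpos
  obtain ⟨M, -, hM⟩ := hu.exists_le_add_radialSol hd hp hR₀ hr hN hN2 hC (H₁ a ha hau hac)
  rcases ha.eq_or_lt with rfl | ha
  · simp only [zero_mul, add_zero] at hM
    exact Or.inl (hu.exists_tendsto hd hp hR₀ hr hpos hN hN1 hN2 hC hM (H₂ M hM))
  · exact Or.inr ⟨a, ha, IsPHarmonic.tendsto_div_radialGauge hd hau hM⟩

end Dichotomy

lemma not_tendsto_and_tendsto_div_radialGauge (hd : 2 ≤ d) {p : ℝ} {u : 𝔼 → ℝ} {c c' : ℝ}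
    (hc' : 0 < c') (h : Tendsto u (Bornology.cobounded 𝔼) (𝓝 c))
    (h' : Tendsto (fun x => u x / radialGauge d p ‖x‖) (Bornology.cobounded 𝔼) (𝓝 c')) : False := by
  have : NeZero d := ⟨by omega⟩
  have hG : Tendsto (fun x : 𝔼 => radialGauge d p ‖x‖) (Bornology.cobounded 𝔼) atTop :=
    (tendsto_radialGauge hd p).comp tendsto_norm_cobounded_atTop
  exact hc'.ne' (tendsto_nhds_unique h' (h.div_atTop hG))

section Supercritical

variable {p R₀ r : ℝ} {u : EuclideanSpace ℝ (Fin d) → ℝ}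

lemma IsPHarmonic.mono {Ω Ω' : Set 𝔼} (hu : IsPHarmonic p Ω u) (h : Ω' ⊆ Ω) :
    IsPHarmonic p Ω' u :=
  ⟨hu.1.mono h, fun φ h1 h2 h3 => hu.2 φ h1 h2 (h3.trans h)⟩

lemma IsPHarmonic.rescale (hu : IsPHarmonic p {x | R₀ < ‖x‖} u) {R : ℝ} (hR : 0 < R)
    (hR' : 4 * R₀ ≤ R) (k c : ℝ) :
    IsPHarmonic p {x : 𝔼 | 1 / 4 < ‖x‖} fun x => k * u (R • x) + c := by
  refine (hu.comp_smul (isOpen_exterior R₀) hR k c).mono fun x hx => ?_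
  have hx' : 1 / 4 < ‖x‖ := hx
  change R₀ < ‖R • x‖
  rw [norm_smul, Real.norm_of_nonneg hR.le]
  nlinarith

lemma norm_inv_smul_self {R : ℝ} (hR : 0 < R) {x : 𝔼} (hx : ‖x‖ = R) : ‖R⁻¹ • x‖ = 1 := by
  rw [norm_smul, hx, norm_inv, Real.norm_of_nonneg hR.le, inv_mul_cancel₀ hR.ne']

lemma IsPHarmonic.exists_sphere_le (hd : 2 ≤ d) (hp : d < p) (hR₀ : 0 < R₀) (hr : R₀ < r)
    (hu : IsPHarmonic p {x | R₀ < ‖x‖} u) (hpos : ∀ x, R₀ < ‖x‖ → 0 < u x) {a : ℝ} (ha : 0 ≤ a)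
    (hau : ∀ x, r ≤ ‖x‖ → a * radialSol p r x ≤ u x)
    (hac : ∀ c > a, ∀ S, ∃ x, S < ‖x‖ ∧ u x < c * radialSol p r x) {ε : ℝ} (hε : 0 < ε) (S : ℝ) :
    ∃ s > S, ∀ x : 𝔼, ‖x‖ = s → r ≤ ‖x‖ → u x ≤ (a + ε) * radialSol p r x := by
  have hr0 : 0 < r := hR₀.trans hr
  obtain ⟨η, hη, H⟩ := exists_gain_sphere hd hp ha (half_pos hε)
  set α := (p - d) / (p - 1) with hα
  have hT : ∀ x : 𝔼, radialSol p r x = ‖x‖ ^ α - r ^ α := fun x => by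
    simp [radialSol, radialGauge, hp, hα]
  have hrα : 0 < r ^ α := by positivity
  obtain ⟨t₀, ht₀⟩ := radialSol_eventually_lt (d := d) hd p r
    (max (a * r ^ α / η) ((a + ε) * r ^ α / (ε / 2)))
  obtain ⟨x, hx, hux⟩ := hac (a + η) (by linarith) (max (max S t₀) (4 * r))
  set R := ‖x‖ with hR
  have hSR : S < R := ((le_max_left _ _).trans (le_max_left _ _)).trans_lt hx
  have htR : t₀ ≤ R := (((le_max_right _ _).trans (le_max_left _ _)).trans_lt hx).le
  have hrR : 4 * r < R := (le_max_right _ _).trans_lt hx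
  have hR0 : 0 < R := by linarith
  have hRα : 0 < R ^ α := by positivity
  have hTx := ht₀ x htR
  rw [max_lt_iff, hT, ← hR, div_lt_iff₀ hη, div_lt_iff₀ (half_pos hε)] at hTx
  refine ⟨R, hSR, fun y hy _ => ?_⟩
  rw [hT, hy]
  by_contra! hcon
  have hcon' : (a + ε / 2) * R ^ α ≤ u y := by nlinarith [hTx.2]
  have key := H (fun z => (R ^ α)⁻¹ * u (R • z) + 0) (hu.rescale hR0 (by linarith) _ 0)
    (fun z hz _ => ?_) ⟨R⁻¹ • y, norm_inv_smul_self hR0 hy, ?_⟩ (R⁻¹ • x)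
    (norm_inv_smul_self hR0 hR.symm)
  · simp only [smul_smul, mul_inv_cancel₀ hR0.ne', one_smul, add_zero] at key
    rw [le_inv_mul_iff₀ hRα] at key
    rw [hT, ← hR] at hux
    nlinarith
  · have hzR : ‖R • z‖ = R * ‖z‖ := by rw [norm_smul, Real.norm_of_nonneg hR0.le]
    have hzr : r ≤ ‖R • z‖ := by rw [hzR]; nlinarith
    refine ⟨?_, ?_⟩
    · have := (hpos (R • z) (hr.trans_le hzr)).le
      positivity
    · have h1 := hau (R • z) hzr
      rw [hT, hzR, Real.mul_rpow hR0.le (norm_nonneg _)] at h1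
      rw [add_zero, le_inv_mul_iff₀ hRα]
      nlinarith [hTx.1]
  · simp only [smul_smul, mul_inv_cancel₀ hR0.ne', one_smul, add_zero]
    rw [le_inv_mul_iff₀ hRα]
    linarith

lemma IsPHarmonic.exists_sphere_osc_le (hd : 2 ≤ d) (hp : d < p) (hR₀ : 0 < R₀)
    (hu : IsPHarmonic p {x | R₀ < ‖x‖} u) (hpos : ∀ x, R₀ < ‖x‖ → 0 < u x) {M : ℝ}
    (hM : ∀ x, r ≤ ‖x‖ → u x ≤ M) {ε : ℝ} (hε : 0 < ε) (S : ℝ) :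
    ∃ s > S, ∃ c, ∀ x : 𝔼, ‖x‖ = s → r ≤ ‖x‖ → c ≤ u x ∧ u x ≤ c + ε := by
  have : NeZero d := ⟨by omega⟩
  obtain ⟨η, hη, H⟩ := exists_gain_sphere (d := d) hd hp le_rfl (half_pos hε)
  simp only [zero_mul, zero_add, zero_sub] at H
  have hnorm := tendsto_norm_cobounded_atTop (E := 𝔼)
  have hbelow : IsBoundedUnder (· ≥ ·) (Bornology.cobounded 𝔼) u :=
    isBoundedUnder_of_eventually_ge (a := 0) (by
      filter_upwards [hnorm.eventually_gt_atTop R₀] with x hx using (hpos x hx).le)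
  have habove : IsBoundedUnder (· ≤ ·) (Bornology.cobounded 𝔼) u :=
    isBoundedUnder_of_eventually_le (a := M) (by
      filter_upwards [hnorm.eventually_ge_atTop r] with x hx using hM x hx)
  set L := liminf u (Bornology.cobounded 𝔼) with hL
  have h1 : ∀ᶠ x in Bornology.cobounded 𝔼, L - η / 2 < u x :=
    eventually_lt_of_lt_liminf (by linarith) hbelow
  have h2 : ∃ᶠ x in Bornology.cobounded 𝔼, u x < L + η / 2 :=
    frequently_lt_of_liminf_lt habove.isCoboundedUnder_ge (by linarith)
  obtain ⟨ρ, hρ⟩ : ∃ ρ, ∀ x : 𝔼, ρ ≤ ‖x‖ → L - η / 2 < u x := by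
    obtain ⟨ρ, -, hρ⟩ := (hasBasis_cobounded_norm (E := 𝔼)).eventually_iff.1 h1
    exact ⟨ρ, fun x hx => hρ hx⟩
  obtain ⟨x, hux, hx⟩ := (h2.and_eventually
    (hnorm.eventually_gt_atTop (max (max S (4 * R₀)) (4 * ρ)))).exists
  set R := ‖x‖ with hR
  have hSR : S < R := ((le_max_left _ _).trans (le_max_left _ _)).trans_lt hx
  have hR₀R : 4 * R₀ ≤ R := (((le_max_right _ _).trans (le_max_left _ _)).trans_lt hx).le
  have hρR : 4 * ρ < R := (le_max_right _ _).trans_lt hx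
  have hR0 : 0 < R := by linarith
  refine ⟨R, hSR, L - η / 2, fun y hy _ => ⟨(hρ y (by linarith)).le, ?_⟩⟩
  by_contra! hcon
  have key := H (fun z => 1 * u (R • z) + -(L - η / 2)) (hu.rescale hR0 hR₀R _ _)
    (fun z hz _ => ?_) ⟨R⁻¹ • y, norm_inv_smul_self hR0 hy, ?_⟩ (R⁻¹ • x)
    (norm_inv_smul_self hR0 hR.symm)
  · simp only [smul_smul, mul_inv_cancel₀ hR0.ne', one_smul, one_mul] at key
    linarith
  · have hzR : ‖R • z‖ = R * ‖z‖ := by rw [norm_smul, Real.norm_of_nonneg hR0.le]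
    have := hρ (R • z) (by rw [hzR]; nlinarith)
    constructor <;> linarith
  · simp only [smul_smul, mul_inv_cancel₀ hR0.ne', one_smul, one_mul]
    linarith

end Supercritical

lemma pFlux_natCast_add_two (m : ℕ) (v : 𝔼) :
    pFlux ((m + 2 : ℕ) : ℝ) v = ‖v‖ ^ m • v := by
  simp [pFlux]

lemma young_pow (n : ℕ) {X Y : ℝ} (hX : 0 ≤ X) (hY : 0 ≤ Y) :
    (n + 1) * X ^ n * Y ≤ X ^ (n + 1) / 2 + (n + 1) * (2 * (n + 1)) ^ n * Y ^ (n + 1) := by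
  rcases le_total (2 * (n + 1) * Y) X with h | h
  · have h1 : (n + 1) * X ^ n * Y ≤ X ^ (n + 1) / 2 := by
      have := mul_le_mul_of_nonneg_left h (pow_nonneg hX n)
      rw [pow_succ]; nlinarith
    have h2 : 0 ≤ (n + 1 : ℝ) * (2 * (n + 1)) ^ n * Y ^ (n + 1) := by positivity
    linarith
  · have h1 : (n + 1) * X ^ n * Y ≤ (n + 1) * (2 * (n + 1)) ^ n * Y ^ (n + 1) := by
      calc (n + 1) * X ^ n * Y ≤ (n + 1) * (2 * (n + 1) * Y) ^ n * Y := by gcongr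
        _ = _ := by rw [mul_pow]; ring
    have h2 : 0 ≤ X ^ (n + 1) / 2 := by positivity
    linarith

/-- The logarithmic Caccioppoli inequality. -/
lemma IsPHarmonic.integral_pow_fderiv_log_le (hd : 2 ≤ d) {Ω : Set 𝔼} (hΩ : IsOpen Ω)
    {u : 𝔼 → ℝ} (hu : IsPHarmonic (d : ℝ) Ω u) (hpos : ∀ x ∈ Ω, 0 < u x) {η : 𝔼 → ℝ}
    (hη : ContDiff ℝ 1 η) (hc : HasCompactSupport η) (hs : tsupport η ⊆ Ω) (h0 : ∀ x, 0 ≤ η x) :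
    Continuous (fun x => (η x * ‖fderiv ℝ (fun y => Real.log (u y)) x‖) ^ d) ∧
    ∫ x, (η x * ‖fderiv ℝ (fun y => Real.log (u y)) x‖) ^ d ≤
      (2 * d : ℝ) ^ d * ∫ x, ‖fderiv ℝ η x‖ ^ d := by
  obtain ⟨m, rfl⟩ : ∃ m, d = m + 2 := ⟨d - 2, by omega⟩
  obtain ⟨hu1, hu2⟩ := hu
  set f : EuclideanSpace ℝ (Fin (m + 2)) → ℝ := fun y => Real.log (u y) with hf
  have hf1 : ContDiffOn ℝ 1 f Ω := hu1.log fun x hx => (hpos x hx).ne'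
  have hηz : ∀ x ∉ tsupport η, η x = 0 := fun x hx => image_eq_zero_of_notMem_tsupport hx
  set φ : EuclideanSpace ℝ (Fin (m + 2)) → ℝ :=
    fun x => η x ^ (m + 2) * Real.exp (-((m + 1) * f x)) with hφ
  have hφz : ∀ x ∉ tsupport η, φ x = 0 := fun x hx => by simp [hφ, hηz x hx]
  have hφts : tsupport φ ⊆ tsupport η := closure_minimal
    (fun x hx => by_contra fun h => hx (hφz x h)) (isClosed_tsupport η)
  have hφ1 : ContDiff ℝ 1 φ := by
    rw [contDiff_iff_contDiffAt]
    intro x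
    by_cases hx : x ∈ Ω
    · have := hf1.contDiffAt (hΩ.mem_nhds hx)
      exact (hη.contDiffAt.pow _).mul (contDiffAt_const.mul this).neg.exp
    · have : φ =ᶠ[𝓝 x] fun _ => 0 := by
        filter_upwards [(isClosed_tsupport η).isOpen_compl.mem_nhds fun h => hx (hs h)] with y hy
        exact hφz y hy
      exact contDiffAt_const.congr_of_eventuallyEq this
  have hφc : HasCompactSupport φ := hc.of_isClosed_subset (isClosed_tsupport φ) hφts
  have hint := hu2 φ hφ1 hφc (hφts.trans hs)
  have hcont := continuous_fderiv_pFlux (p := ((m + 2 : ℕ) : ℝ)) (by norm_num) hΩ hu1 hφ1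
    (hφts.trans hs)
  have hcX : Continuous fun x => (η x * ‖fderiv ℝ f x‖) ^ (m + 2) := by
    refine continuous_of_continuousOn_of_zero hΩ (isClosed_tsupport η) hs ?_ fun x hx => by
      simp [hηz x hx]
    exact (hη.continuous.continuousOn.mul
      (hf1.continuousOn_fderiv_of_isOpen hΩ le_rfl).norm).pow _
  have hcY : Continuous fun x => ‖fderiv ℝ η x‖ ^ (m + 2) :=
    (hη.continuous_fderiv one_ne_zero).norm.pow _
  have hiX : Integrable fun x => (η x * ‖fderiv ℝ f x‖) ^ (m + 2) := by
    refine hcX.integrable_of_hasCompactSupport (hc.mono' fun x hx => ?_)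
    by_contra h
    exact hx (by simp [hηz x h])
  have hiY : Integrable fun x => ‖fderiv ℝ η x‖ ^ (m + 2) := by
    refine hcY.integrable_of_hasCompactSupport ((hc.fderiv ℝ).mono fun x hx h => hx ?_)
    simp [h]
  have hiI : Integrable fun x => fderiv ℝ φ x (pFlux ((m + 2 : ℕ) : ℝ) (gradient u x)) := by
    refine hcont.integrable_of_hasCompactSupport ((hφc.fderiv ℝ).mono fun x hx h => hx ?_)
    simp [h]
  have hpt : ∀ x, fderiv ℝ φ x (pFlux ((m + 2 : ℕ) : ℝ) (gradient u x)) ≤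
      -((η x * ‖fderiv ℝ f x‖) ^ (m + 2) / 2) +
      ((m + 1 : ℕ) + 1) * (2 * ((m + 1 : ℕ) + 1)) ^ (m + 1) * ‖fderiv ℝ η x‖ ^ (m + 2) := by
    intro x
    by_cases hx : x ∈ Ω
    · have hux := hpos x hx
      have hud : DifferentiableAt ℝ u x :=
        (hu1.contDiffAt (hΩ.mem_nhds hx)).differentiableAt one_ne_zero
      have hfd : HasFDerivAt f ((u x)⁻¹ • fderiv ℝ u x) x := hud.hasFDerivAt.log hux.ne'
      have hgr : gradient u x = u x • gradient f x := by
        simp only [gradient, hfd.fderiv, map_smulₛₗ]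
        simp [smul_smul, hux.ne']
      have hηd := (hη.differentiable one_ne_zero x).hasFDerivAt
      have hF : HasFDerivAt f (fderiv ℝ f x) x := hfd.differentiableAt.hasFDerivAt
      have hφd := (hηd.pow (m + 2)).mul (hF.const_mul ((m : ℝ) + 1)).neg.exp
      set g := gradient f x with hg
      have hng : ‖g‖ = ‖fderiv ℝ f x‖ := by simp [hg, gradient]
      have hFg : fderiv ℝ f x g = ‖g‖ ^ 2 := by
        rw [← real_inner_self_eq_norm_sq, hg, inner_gradient_left]
      have hE : Real.exp (-((m + 1) * f x)) * (u x ^ m * u x) = 1 := by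
        rw [← pow_succ, Real.exp_neg, mul_comm ((m : ℝ) + 1), hf, Real.exp_mul,
          Real.exp_log hux]
        have : u x ^ ((m : ℝ) + 1) = u x ^ (m + 1) := by
          rw [← Real.rpow_natCast]; norm_num
        rw [this]
        exact inv_mul_cancel₀ (by positivity)
      have hval : fderiv ℝ φ x (pFlux ((m + 2 : ℕ) : ℝ) (gradient u x)) =
          (m + 2) * η x ^ (m + 1) * (‖g‖ ^ m * fderiv ℝ η x g) -
            (m + 1) * (η x * ‖g‖) ^ (m + 2) := by
        have e1 : fderiv ℝ φ x = _ := hφd.fderiv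
        rw [e1, hgr, pFlux_natCast_add_two, norm_smul, Real.norm_of_nonneg hux.le]
        simp only [add_apply, smul_apply, neg_apply, map_smul, smul_eq_mul, hFg]
        set E := Real.exp (-((m + 1) * f x)) with hEdef
        push_cast
        simp only [nsmul_eq_mul]
        push_cast
        linear_combination ((m + 2) * η x ^ (m + 1) * (‖g‖ ^ m * fderiv ℝ η x g) -
            (m + 1) * (η x * ‖g‖) ^ (m + 2)) * hE
      rw [hval, ← hng]
      have hY := young_pow (m + 1) (X := η x * ‖g‖) (Y := ‖fderiv ℝ η x‖)
        (mul_nonneg (h0 x) (norm_nonneg _)) (norm_nonneg _)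
      have hle : (m + 2) * η x ^ (m + 1) * (‖g‖ ^ m * fderiv ℝ η x g) ≤
          ((m + 1 : ℕ) + 1) * (η x * ‖g‖) ^ (m + 1) * ‖fderiv ℝ η x‖ := by
        have h3 : fderiv ℝ η x g ≤ ‖fderiv ℝ η x‖ * ‖g‖ :=
          (le_abs_self _).trans ((fderiv ℝ η x).le_opNorm g)
        have h4 := h0 x
        calc _ ≤ (m + 2) * η x ^ (m + 1) * (‖g‖ ^ m * (‖fderiv ℝ η x‖ * ‖g‖)) := by gcongr
          _ = _ := by push_cast; ring
      have hX0 : 0 ≤ (η x * ‖g‖) ^ (m + 2) := pow_nonneg (mul_nonneg (h0 x) (norm_nonneg _)) _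
      have hm : (0 : ℝ) ≤ m := m.cast_nonneg
      have := mul_nonneg hm hX0
      have hY' : _ ≤ (η x * ‖g‖) ^ (m + 2) / 2 +
        ((m + 1 : ℕ) + 1) * (2 * ((m + 1 : ℕ) + 1)) ^ (m + 1) * ‖fderiv ℝ η x‖ ^ (m + 2) := hY
      linarith
    · have h1 : x ∉ tsupport η := fun h => hx (hs h)
      have h2 : x ∉ tsupport (fderiv ℝ φ) :=
        fun h => h1 (hφts (tsupport_fderiv_subset ℝ h))
      have h3 : x ∉ tsupport (fderiv ℝ η) := fun h => h1 (tsupport_fderiv_subset ℝ h)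
      simp [image_eq_zero_of_notMem_tsupport h2, image_eq_zero_of_notMem_tsupport h3, hηz x h1]
  refine ⟨hcX, ?_⟩
  have hmono := integral_mono hiI ((hiX.div_const 2).neg.add (hiY.const_mul _)) hpt
  have hsum : ∫ x, (-((η x * ‖fderiv ℝ f x‖) ^ (m + 2) / 2) +
      ((m + 1 : ℕ) + 1) * (2 * ((m + 1 : ℕ) + 1)) ^ (m + 1) * ‖fderiv ℝ η x‖ ^ (m + 2)) =
      -((∫ x, (η x * ‖fderiv ℝ f x‖) ^ (m + 2)) / 2) +
      ((m + 1 : ℕ) + 1) * (2 * ((m + 1 : ℕ) + 1)) ^ (m + 1) * ∫ x, ‖fderiv ℝ η x‖ ^ (m + 2) := by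
    rw [← integral_div, ← integral_neg, ← integral_const_mul]
    exact integral_add (hiX.div_const 2).neg (hiY.const_mul _)
  have e3 : ∫ x, fderiv ℝ φ x (pFlux ((m + 2 : ℕ) : ℝ) (gradient u x)) ≤ _ :=
    hmono.trans_eq hsum
  rw [hint] at e3
  have e4 : (2 * ((m + 2 : ℕ) : ℝ)) ^ (m + 2) =
      2 * (((m + 1 : ℕ) + 1) * (2 * (((m + 1 : ℕ) : ℝ) + 1)) ^ (m + 1)) := by
    push_cast; ring
  rw [e4]
  linarith

lemma integral_pow_fderiv_comp_inv_smul {B : 𝔼 → ℝ} (hB : ContDiff ℝ 1 B) {k : ℝ} (hk : 0 < k) :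
    ∫ x, ‖fderiv ℝ (fun x => B (k⁻¹ • x)) x‖ ^ d = ∫ x, ‖fderiv ℝ B x‖ ^ d := by
  have h1 : ∀ x, ‖fderiv ℝ (fun x => B (k⁻¹ • x)) x‖ ^ d =
      (k ^ d)⁻¹ * ‖fderiv ℝ B (k⁻¹ • x)‖ ^ d := by
    intro x
    have h2 : HasFDerivAt (fun x : 𝔼 => k⁻¹ • x) (k⁻¹ • ContinuousLinearMap.id ℝ 𝔼) x :=
      (hasFDerivAt_id x).const_smul k⁻¹
    have h3 := ((hB.differentiable one_ne_zero) (k⁻¹ • x)).hasFDerivAt.comp x h2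
    have h4 : fderiv ℝ (fun x => B (k⁻¹ • x)) x = k⁻¹ • fderiv ℝ B (k⁻¹ • x) := by
      refine h3.fderiv.trans ?_
      ext y; simp
    rw [h4, norm_smul, mul_pow, Real.norm_of_nonneg (by positivity), inv_pow]
  simp_rw [h1]
  rw [integral_const_mul,
    Measure.integral_comp_inv_smul_of_nonneg volume (fun x => ‖fderiv ℝ B x‖ ^ d) hk.le]
  simp [hk.ne']

/-- The logarithm of a positive `d`-harmonic function in an exterior domain agrees near infinity
with a function of finite conformal energy. -/
lemma IsPHarmonic.exists_log_extension (hd : 2 ≤ d) {R₀ : ℝ} (hR₀ : 0 < R₀) {u : 𝔼 → ℝ}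
    (hu : IsPHarmonic (d : ℝ) {x : 𝔼 | R₀ < ‖x‖} u) (hpos : ∀ x : 𝔼, R₀ < ‖x‖ → 0 < u x) :
    ∃ V : 𝔼 → ℝ, ContDiff ℝ 1 V ∧ (∀ x, R₀ + 2 ≤ ‖x‖ → V x = Real.log (u x)) ∧
      Integrable fun x => ‖fderiv ℝ V x‖ ^ d := by
  have hΩ := isOpen_exterior (d := d) R₀
  set f : 𝔼 → ℝ := fun y => Real.log (u y) with hf
  have hf1 : ContDiffOn ℝ 1 f {x : 𝔼 | R₀ < ‖x‖} := hu.1.log fun x hx => (hpos x hx).ne'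
  let A : ContDiffBump (0 : 𝔼) := ⟨R₀ + 1, R₀ + 2, by positivity, by linarith⟩
  let B : ContDiffBump (0 : 𝔼) := ⟨1, 2, one_pos, one_lt_two⟩
  set χ : 𝔼 → ℝ := fun x => 1 - A x with hχ
  have hA1 : ContDiff ℝ 1 A := A.contDiff
  have hB1 : ContDiff ℝ 1 B := B.contDiff
  have hχ1 : ContDiff ℝ 1 χ := contDiff_const.sub hA1
  have hχ0 : ∀ x, 0 ≤ χ x := fun x => sub_nonneg.2 A.le_one
  have hχle : ∀ x, χ x ≤ 1 := fun x => sub_le_self _ A.nonneg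
  have hχin : ∀ x, ‖x‖ ≤ R₀ + 1 → χ x = 0 := fun x hx => by
    simp only [hχ]
    rw [A.one_of_mem_closedBall (by simpa [A] using hx), sub_self]
  have hχout : ∀ x, R₀ + 2 ≤ ‖x‖ → χ x = 1 := fun x hx => by
    simp only [hχ]
    rw [A.zero_of_le_dist (by simpa [A] using hx), sub_zero]
  have hχts : tsupport χ ⊆ {x : 𝔼 | R₀ + 1 ≤ ‖x‖} := by
    refine closure_minimal (fun x hx => ?_) (isClosed_le continuous_const continuous_norm)
    by_contra h
    exact hx (hχin x (le_of_lt (not_le.1 h)))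
  set V : 𝔼 → ℝ := fun x => χ x * f x with hV
  have hV1 : ContDiff ℝ 1 V := by
    rw [contDiff_iff_contDiffAt]
    intro x
    by_cases hx : R₀ < ‖x‖
    · exact hχ1.contDiffAt.mul (hf1.contDiffAt (hΩ.mem_nhds hx))
    · have : V =ᶠ[𝓝 x] fun _ => 0 := by
        have h1 : ∀ᶠ y : 𝔼 in 𝓝 x, ‖y‖ < R₀ + 1 :=
          continuous_norm.continuousAt.eventually (gt_mem_nhds (by linarith))
        filter_upwards [h1] with y hy
        simp [hV, hχin y hy.le]
      exact contDiffAt_const.congr_of_eventuallyEq this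
  have hVf : ∀ x, R₀ + 2 ≤ ‖x‖ → V x = f x := fun x hx => by simp [hV, hχout x hx]
  have hVfd : ∀ x, R₀ + 2 < ‖x‖ → fderiv ℝ V x = fderiv ℝ f x := fun x hx => by
    refine Filter.EventuallyEq.fderiv_eq ?_
    have h1 : ∀ᶠ y : 𝔼 in 𝓝 x, R₀ + 2 < ‖y‖ :=
      continuous_norm.continuousAt.eventually (lt_mem_nhds hx)
    filter_upwards [h1] with y hy using hVf y hy.le
  have hVc : Continuous fun x => ‖fderiv ℝ V x‖ ^ d :=
    (hV1.continuous_fderiv one_ne_zero).norm.pow d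
  refine ⟨V, hV1, hVf, ?_⟩
  have hAint : Integrable fun x => ‖fderiv ℝ χ x‖ ^ d := by
    refine Continuous.integrable_of_hasCompactSupport
      ((hχ1.continuous_fderiv one_ne_zero).norm.pow d) ?_
    refine (A.hasCompactSupport.fderiv ℝ).mono fun x hx h => hx ?_
    have : fderiv ℝ χ x = -fderiv ℝ A x := by
      simp only [hχ]; rw [fderiv_const_sub]
    simp [this, h, show d ≠ 0 by omega]
  have hBint : ∀ k : ℝ, 0 < k → Integrable fun x => ‖fderiv ℝ (fun x => B (k⁻¹ • x)) x‖ ^ d := by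
    intro k hk
    have hk1 : ContDiff ℝ 1 fun x : 𝔼 => B (k⁻¹ • x) := hB1.comp (contDiff_const_smul k⁻¹)
    refine Continuous.integrable_of_hasCompactSupport
      ((hk1.continuous_fderiv one_ne_zero).norm.pow d) ?_
    have := B.hasCompactSupport.comp_homeomorph
      (Homeomorph.smulOfNeZero k⁻¹ (inv_ne_zero hk.ne'))
    refine (this.fderiv ℝ).mono fun x hx h => hx ?_
    have h' : fderiv ℝ (fun x => B (k⁻¹ • x)) x = 0 := h
    simp [h', show d ≠ 0 by omega]
  set C : ℝ := (2 * d : ℝ) ^ d * (2 ^ (d - 1) *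
    ((∫ x, ‖fderiv ℝ χ x‖ ^ d) + ∫ x, ‖fderiv ℝ B x‖ ^ d)) with hC
  have key : ∀ k : ℝ, 0 < k →
      (Integrable fun x => (χ x * B (k⁻¹ • x) * ‖fderiv ℝ f x‖) ^ d) ∧
      ∫ x, (χ x * B (k⁻¹ • x) * ‖fderiv ℝ f x‖) ^ d ≤ C := by
    intro k hk
    set b : 𝔼 → ℝ := fun x => B (k⁻¹ • x) with hb
    have hb1 : ContDiff ℝ 1 b := hB1.comp (contDiff_const_smul k⁻¹)
    have hbc : HasCompactSupport b := B.hasCompactSupport.comp_homeomorph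
      (Homeomorph.smulOfNeZero k⁻¹ (inv_ne_zero hk.ne'))
    have hηc : HasCompactSupport fun x => χ x * b x := hbc.mul_left
    have hηs : tsupport (fun x => χ x * b x) ⊆ {x : 𝔼 | R₀ < ‖x‖} := by
      refine (closure_mono (Function.support_mul_subset_left χ b)).trans (hχts.trans ?_)
      intro x (hx : R₀ + 1 ≤ ‖x‖)
      exact show R₀ < ‖x‖ by linarith
    obtain ⟨h1, h2⟩ := hu.integral_pow_fderiv_log_le hd hΩ hpos (hχ1.mul hb1) hηc hηs
      fun x => mul_nonneg (hχ0 x) B.nonneg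
    refine ⟨h1.integrable_of_hasCompactSupport (hηc.mono fun x hx h => hx ?_), h2.trans ?_⟩
    · have : χ x * b x = 0 := h
      simp [this, show d ≠ 0 by omega]
    · rw [hC]
      refine mul_le_mul_of_nonneg_left ?_ (by positivity)
      rw [← integral_pow_fderiv_comp_inv_smul hB1 hk, ← integral_add hAint (hBint k hk),
        ← integral_const_mul]
      refine integral_mono_of_nonneg (Eventually.of_forall fun x => by positivity)
        ((hAint.add (hBint k hk)).const_mul _) (Eventually.of_forall fun x => ?_)
      have h3 : fderiv ℝ (fun x => χ x * b x) x = χ x • fderiv ℝ b x + b x • fderiv ℝ χ x :=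
        (((hχ1.differentiable one_ne_zero) x).hasFDerivAt.mul
          ((hb1.differentiable one_ne_zero) x).hasFDerivAt).fderiv
      have h4 : ‖fderiv ℝ (fun x => χ x * b x) x‖ ≤ ‖fderiv ℝ χ x‖ + ‖fderiv ℝ b x‖ := by
        rw [h3, add_comm]
        refine (norm_add_le _ _).trans (add_le_add ?_ ?_)
        · rw [norm_smul, Real.norm_of_nonneg B.nonneg]
          exact mul_le_of_le_one_left (norm_nonneg _) B.le_one
        · rw [norm_smul, Real.norm_of_nonneg (hχ0 x)]
          exact mul_le_of_le_one_left (norm_nonneg _) (hχle x)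
      exact (pow_le_pow_left₀ (norm_nonneg _) h4 d).trans
        (add_pow_le (norm_nonneg _) (norm_nonneg _) d)
  refine AECover.integrable_of_integral_bounded_of_nonneg_ae
    (aecover_closedBall (x := (0 : 𝔼)) tendsto_id)
    ((∫ x in closedBall (0 : 𝔼) (R₀ + 2), ‖fderiv ℝ V x‖ ^ d) + C)
    (fun i => hVc.continuousOn.integrableOn_compact (isCompact_closedBall _ _))
    (Eventually.of_forall fun x => by positivity) ?_
  filter_upwards [eventually_gt_atTop 0] with k hk
  obtain ⟨h1, h2⟩ := key k hk
  have hKi : Integrable (indicator (closedBall (0 : 𝔼) (R₀ + 2)) fun x => ‖fderiv ℝ V x‖ ^ d) :=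
    (hVc.continuousOn.integrableOn_compact (isCompact_closedBall _ _)).integrable_indicator
      measurableSet_closedBall
  refine le_trans ?_ (add_le_add_right h2 _)
  rw [← integral_indicator measurableSet_closedBall, ← integral_indicator measurableSet_closedBall,
    ← integral_add hKi h1]
  refine integral_mono_of_nonneg (Eventually.of_forall fun x =>
    indicator_nonneg (fun x _ => by positivity) x) (hKi.add h1) (Eventually.of_forall fun x => ?_)
  have hB0 : 0 ≤ (χ x * B (k⁻¹ • x) * ‖fderiv ℝ f x‖) ^ d :=
    pow_nonneg (mul_nonneg (mul_nonneg (hχ0 x) B.nonneg) (norm_nonneg _)) d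
  by_cases hx : ‖x‖ ≤ R₀ + 2
  · have hx' : x ∈ closedBall (0 : 𝔼) (R₀ + 2) := by simpa using hx
    have : indicator (closedBall (0 : 𝔼) (id k)) (fun x => ‖fderiv ℝ V x‖ ^ d) x ≤
        ‖fderiv ℝ V x‖ ^ d := indicator_le_self' (fun _ _ => by positivity) x
    simp only [indicator_of_mem hx']
    linarith
  · by_cases hxk : ‖x‖ ≤ k
    · have hx' : x ∈ closedBall (0 : 𝔼) (id k) := by simpa using hxk
      have hBx : B (k⁻¹ • x) = 1 := by
        refine B.one_of_mem_closedBall ?_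
        have : k⁻¹ * ‖x‖ ≤ 1 := by rw [inv_mul_le_iff₀ hk]; simpa using hxk
        simpa [B, norm_smul, abs_of_pos hk] using this
      have h3 : 0 ≤ indicator (closedBall (0 : 𝔼) (R₀ + 2)) (fun x => ‖fderiv ℝ V x‖ ^ d) x :=
        indicator_nonneg (fun x _ => by positivity) x
      simp only [indicator_of_mem hx', hBx, hχout x (not_le.1 hx).le, hVfd x (not_le.1 hx)]
      simp only [one_mul]
      linarith
    · have hx' : x ∉ closedBall (0 : 𝔼) (id k) := by simpa using hxk
      rw [indicator_of_notMem hx']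
      exact add_nonneg (indicator_nonneg (fun x _ => by positivity) x) hB0

/-- The energy outside large balls is small. -/
lemma exists_setIntegral_exterior_le {g : 𝔼 → ℝ} (hg : Integrable g) {ε : ℝ} (hε : 0 < ε) :
    ∃ S, ∀ R, S ≤ R → ∫ x in {x : 𝔼 | R < ‖x‖}, g x ≤ ε := by
  have h := AECover.integral_tendsto_of_countably_generated
    (aecover_closedBall (μ := volume) (x := (0 : 𝔼)) tendsto_id) hg
  obtain ⟨S, hS⟩ := eventually_atTop.1 (h.eventually (lt_mem_nhds (sub_lt_self _ hε)))
  refine ⟨S, fun R hR => ?_⟩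
  have h1 := integral_add_compl (measurableSet_closedBall (x := (0 : 𝔼)) (ε := R)) hg
  have h2 : (closedBall (0 : 𝔼) R)ᶜ = {x : 𝔼 | R < ‖x‖} := by ext x; simp
  have h3 := hS R hR
  rw [h2] at h1
  simp only [id] at h3
  linarith

lemma pow_mul_setIntegral_comp_homothety_le {n : ℕ} {Q : Set (Fin n → ℝ)} (hQ : IsCompact Q)
    (hQc : Convex ℝ Q) {g : (Fin n → ℝ) → ℝ} (hg : Continuous g) (hg0 : ∀ z, 0 ≤ g z)
    {x : Fin n → ℝ} (hx : x ∈ Q) {σ : ℝ} (hσ : 0 < σ) (hσ1 : σ ≤ 1) :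
    σ ^ n * ∫ z in Q, g (x + σ • (z - x)) ≤ ∫ z in Q, g z := by
  have hm := hQ.isClosed.measurableSet
  set G := indicator Q g with hG
  have hGi : Integrable G := (hg.continuousOn.integrableOn_compact hQ).integrable_indicator hm
  set c := x - σ • x with hc
  have h1 : ∫ z, G (c + σ • z) = (σ ^ n)⁻¹ * ∫ z, G z := by
    have := Measure.integral_comp_smul_of_nonneg volume (fun w => G (c + w)) σ (hR := hσ.le)
    rw [this, integral_add_left_eq_self G c]
    simp
  have h2 : Integrable fun z => G (c + σ • z) :=
    (hGi.comp_add_left c).comp_smul hσ.ne'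
  have h3 : ∫ z in Q, g (x + σ • (z - x)) ≤ ∫ z, G (c + σ • z) := by
    rw [← integral_indicator hm]
    refine integral_mono_of_nonneg (Eventually.of_forall fun z =>
      indicator_nonneg (fun z _ => hg0 _) z) h2 (Eventually.of_forall fun z => ?_)
    have e : c + σ • z = x + σ • (z - x) := by rw [hc, smul_sub]; abel
    by_cases hz : z ∈ Q
    · have hz' : x + σ • (z - x) ∈ Q := hQc.add_smul_sub_mem hx hz ⟨hσ.le, hσ1⟩
      simp [indicator_of_mem hz, hG, e, indicator_of_mem hz']
    · simp only [indicator_of_notMem hz]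
      exact indicator_nonneg (fun z _ => hg0 _) _
  rw [h1, hG, integral_indicator hm] at h3
  calc _ ≤ σ ^ n * ((σ ^ n)⁻¹ * ∫ z in Q, g z) := by gcongr
    _ = _ := by field_simp

lemma le_add_inv_pow_mul_pow (n : ℕ) {μ X : ℝ} (hμ : 0 < μ) (hX : 0 ≤ X) :
    X ≤ μ + (μ ^ n)⁻¹ * X ^ (n + 1) := by
  rcases le_total X μ with h | h
  · have : 0 ≤ (μ ^ n)⁻¹ * X ^ (n + 1) := by positivity
    linarith
  · have : X ≤ (μ ^ n)⁻¹ * X ^ (n + 1) := by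
      rw [le_inv_mul_iff₀ (by positivity), pow_succ]
      gcongr
    linarith

lemma abs_setIntegral_sub_le (n : ℕ) {f : (Fin n → ℝ) → ℝ} (hf : ContDiff ℝ 1 f) {μ : ℝ}
    (hμ : 0 < μ)
    (hE : ∫ z in closedBall (0 : Fin n → ℝ) 2, ‖fderiv ℝ f z‖ ^ (n + 1) ≤ μ ^ (n + 1))
    {x : Fin n → ℝ} (hx : x ∈ closedBall (0 : Fin n → ℝ) 2) :
    |∫ z in closedBall (0 : Fin n → ℝ) 2, (f z - f x)| ≤
      (n + 1) * 4 * (volume.real (closedBall (0 : Fin n → ℝ) 2) + 1) * μ := by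
  set Q := closedBall (0 : Fin n → ℝ) 2 with hQ
  have hQk : IsCompact Q := isCompact_closedBall _ _
  have hQm : MeasurableSet Q := measurableSet_closedBall
  have hQc : Convex ℝ Q := convex_closedBall _ _
  have : IsFiniteMeasure (volume.restrict Q) := ⟨by simpa using hQk.measure_lt_top⟩
  have hf' : Continuous (fderiv ℝ f) := hf.continuous_fderiv one_ne_zero
  set D : ℝ → (Fin n → ℝ) → ℝ := fun s z => s ^ n * ‖fderiv ℝ f (x + s ^ (n + 1) • (z - x))‖
    with hD
  have hDc : Continuous (Function.uncurry D) := by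
    simp only [hD, Function.uncurry_def]
    fun_prop
  have hpt : ∀ z ∈ Q, |f z - f x| ≤ (n + 1) * 4 * ∫ s in (0 : ℝ)..1, D s z := by
    intro z hz
    have hder : ∀ s ∈ uIcc (0 : ℝ) 1, HasDerivAt (fun s : ℝ => f (x + s ^ (n + 1) • (z - x)))
        (fderiv ℝ f (x + s ^ (n + 1) • (z - x)) (((n + 1 : ℕ) * s ^ n) • (z - x))) s := by
      intro s _
      have h1 : HasDerivAt (fun s : ℝ => x + s ^ (n + 1) • (z - x))
          (((n + 1 : ℕ) * s ^ n) • (z - x)) s := by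
        simpa using ((hasDerivAt_pow (n + 1) s).smul_const (z - x)).const_add x
      exact ((hf.differentiable one_ne_zero _).hasFDerivAt).comp_hasDerivAt s h1
    have hcont : Continuous fun s : ℝ =>
        fderiv ℝ f (x + s ^ (n + 1) • (z - x)) (((n + 1 : ℕ) * s ^ n) • (z - x)) :=
      (hf'.comp (by fun_prop)).clm_apply (by fun_prop)
    have hftc := intervalIntegral.integral_eq_sub_of_hasDerivAt hder
      (hcont.intervalIntegrable 0 1)
    have e : f z - f x = ∫ s in (0 : ℝ)..1,
        fderiv ℝ f (x + s ^ (n + 1) • (z - x)) (((n + 1 : ℕ) * s ^ n) • (z - x)) := by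
      rw [hftc]; simp
    have hzx : ‖z - x‖ ≤ 4 := by
      have h1 : ‖z‖ ≤ 2 := by simpa [hQ] using hz
      have h2 : ‖x‖ ≤ 2 := by simpa [hQ] using hx
      exact (norm_sub_le _ _).trans (by linarith)
    rw [e, ← Real.norm_eq_abs, ← intervalIntegral.integral_const_mul]
    refine intervalIntegral.norm_integral_le_of_norm_le zero_le_one
      (Eventually.of_forall fun s hs => ?_)
      (Continuous.intervalIntegrable (by simp only [hD]; fun_prop) _ _)
    refine ((fderiv ℝ f _).le_opNorm _).trans ?_
    have hs0 : 0 ≤ s := hs.1.le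
    rw [norm_smul, Real.norm_of_nonneg (by positivity)]
    simp only [hD]
    calc _ ≤ ‖fderiv ℝ f (x + s ^ (n + 1) • (z - x))‖ * (((n + 1 : ℕ) * s ^ n) * 4) := by gcongr
      _ = _ := by push_cast; ring
  have hint : Integrable (fun z => ∫ s in (0 : ℝ)..1, D s z) (volume.restrict Q) := by
    have hDc' : Continuous (Function.uncurry fun z s => D s z) := hDc.comp continuous_swap
    exact (intervalIntegral.continuous_parametric_intervalIntegral_of_continuous' hDc'
      0 1).continuousOn.integrableOn_compact hQk
  have hprod : Integrable (Function.uncurry D)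
      ((volume.restrict (Ioc (0 : ℝ) 1)).prod (volume.restrict Q)) := by
    rw [Measure.prod_restrict]
    exact (hDc.continuousOn.integrableOn_compact (isCompact_Icc.prod hQk)).mono_set
      (prod_mono_left Ioc_subset_Icc_self)
  have hswap : ∫ z in Q, ∫ s in (0 : ℝ)..1, D s z = ∫ s in Ioc (0 : ℝ) 1, ∫ z in Q, D s z := by
    simp_rw [intervalIntegral.integral_of_le zero_le_one]
    exact (integral_integral_swap hprod).symm
  have hinner : ∀ s ∈ Ioc (0 : ℝ) 1, ∫ z in Q, D s z ≤ (volume.real Q + 1) * μ := by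
    intro s hs
    set g : (Fin n → ℝ) → ℝ := fun z => ‖fderiv ℝ f z‖ ^ (n + 1) with hg
    have hgc : Continuous g := hf'.norm.pow _
    have h1 := pow_mul_setIntegral_comp_homothety_le hQk hQc hgc (fun z => by positivity) hx
      (pow_pos hs.1 (n + 1)) (pow_le_one₀ hs.1.le hs.2)
    have hi : IntegrableOn (fun z => g (x + s ^ (n + 1) • (z - x))) Q :=
      (hgc.comp (by fun_prop)).continuousOn.integrableOn_compact hQk
    have h2 : ∫ z in Q, D s z ≤
        ∫ z in Q, (μ + (μ ^ n)⁻¹ * ((s ^ (n + 1)) ^ n * g (x + s ^ (n + 1) • (z - x)))) := by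
      refine integral_mono ?_ ((integrable_const _).add ((hi.const_mul _).const_mul _)) fun z => ?_
      · exact (hDc.comp (Continuous.prodMk_right s)).continuousOn.integrableOn_compact hQk
      · refine (le_add_inv_pow_mul_pow n hμ (X := D s z)
          (mul_nonneg (pow_nonneg hs.1.le n) (norm_nonneg _))).trans_eq ?_
        simp only [hD, hg]
        ring
    refine h2.trans ?_
    rw [integral_add (integrable_const _) ((hi.const_mul _).const_mul _), integral_const_mul,
      integral_const_mul, setIntegral_const, smul_eq_mul]
    have h3 : (μ ^ n)⁻¹ * ((s ^ (n + 1)) ^ n * ∫ z in Q, g (x + s ^ (n + 1) • (z - x))) ≤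
        (μ ^ n)⁻¹ * μ ^ (n + 1) := by
      gcongr
      exact h1.trans hE
    have h4 : (μ ^ n)⁻¹ * μ ^ (n + 1) = μ := by rw [pow_succ]; field_simp
    linarith
  have hbound : ∫ s in Ioc (0 : ℝ) 1, ∫ z in Q, D s z ≤ (volume.real Q + 1) * μ := by
    refine (setIntegral_mono_on hprod.integral_prod_left (integrable_const _) measurableSet_Ioc
      hinner).trans_eq ?_
    simp
  calc |∫ z in Q, (f z - f x)| ≤ ∫ z in Q, |f z - f x| := abs_integral_le_integral_abs
    _ ≤ ∫ z in Q, (n + 1) * 4 * ∫ s in (0 : ℝ)..1, D s z := by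
        refine setIntegral_mono_on ?_ (hint.const_mul _) hQm hpt
        exact ((hf.continuous.sub continuous_const).abs).continuousOn.integrableOn_compact hQk
    _ = (n + 1) * 4 * ∫ s in Ioc (0 : ℝ) 1, ∫ z in Q, D s z := by
        rw [integral_const_mul, hswap]
    _ ≤ _ := by
        rw [mul_assoc ((n + 1 : ℝ) * 4)]
        gcongr

/-- Morrey's inequality on a cube, in the form of an oscillation bound. -/
lemma exists_abs_sub_le_of_energy (n : ℕ) : ∃ C : ℝ, 0 < C ∧
    ∀ (f : (Fin n → ℝ) → ℝ) (μ : ℝ), ContDiff ℝ 1 f → 0 < μ →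
      ∫ z in closedBall (0 : Fin n → ℝ) 2, ‖fderiv ℝ f z‖ ^ (n + 1) ≤ μ ^ (n + 1) →
      ∀ x ∈ closedBall (0 : Fin n → ℝ) 2, ∀ y ∈ closedBall (0 : Fin n → ℝ) 2,
        |f x - f y| ≤ C * μ := by
  set Q := closedBall (0 : Fin n → ℝ) 2 with hQ
  have hQk : IsCompact Q := isCompact_closedBall _ _
  have hV : 0 < volume.real Q :=
    ENNReal.toReal_pos (measure_closedBall_pos volume _ two_pos).ne' hQk.measure_lt_top.ne
  have : IsFiniteMeasure (volume.restrict Q) := ⟨by simpa using hQk.measure_lt_top⟩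
  refine ⟨(volume.real Q)⁻¹ * (2 * ((n + 1) * 4 * (volume.real Q + 1))), by positivity, ?_⟩
  intro f μ hf hμ hE x hx y hy
  have hfi : IntegrableOn f Q := hf.continuous.continuousOn.integrableOn_compact hQk
  have key : ∀ w, ∫ z in Q, (f z - f w) = (∫ z in Q, f z) - volume.real Q * f w := by
    intro w
    rw [integral_sub hfi (integrable_const _), setIntegral_const, smul_eq_mul]
  have h1 := abs_setIntegral_sub_le n hf hμ hE hx
  have h2 := abs_setIntegral_sub_le n hf hμ hE hy
  rw [key] at h1 h2
  rw [abs_le] at h1 h2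
  rw [mul_assoc, le_inv_mul_iff₀ hV, ← abs_of_pos hV, ← abs_mul, abs_of_pos hV, abs_le]
  constructor <;> nlinarith

/-- Insert the coordinate `t` at position `i`. -/
def insertCoord {n : ℕ} (i : Fin (n + 1)) (t : ℝ) (y : Fin n → ℝ) : Fin (n + 1) → ℝ :=
  i.insertNth t y

@[simp] lemma insertCoord_same {n : ℕ} (i : Fin (n + 1)) (t : ℝ) (y : Fin n → ℝ) :
    insertCoord i t y i = t := by simp [insertCoord]

@[simp] lemma insertCoord_succAbove {n : ℕ} (i : Fin (n + 1)) (t : ℝ) (y : Fin n → ℝ)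
    (k : Fin n) : insertCoord i t y (i.succAbove k) = y k := by simp [insertCoord]

lemma continuous_insertCoord {n : ℕ} (i : Fin (n + 1)) :
    Continuous fun p : ℝ × (Fin n → ℝ) => insertCoord i p.1 p.2 := by
  refine continuous_pi fun j => ?_
  refine Fin.succAboveCases i ?_ (fun k => ?_) j
  · simpa using continuous_fst
  · simp only [insertCoord_succAbove]
    exact (continuous_apply k).comp continuous_snd

lemma integrableOn_slice {n : ℕ} {G : (Fin (n + 1) → ℝ) → ℝ} (hG : Continuous G)
    (i : Fin (n + 1)) :
    Integrable (fun p : ℝ × (Fin n → ℝ) => G (insertCoord i p.1 p.2))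
      ((volume.restrict (Icc (1 : ℝ) 2)).prod
        (volume.restrict (closedBall (0 : Fin n → ℝ) 2))) := by
  rw [Measure.prod_restrict]
  have : Continuous fun p : ℝ × (Fin n → ℝ) => G (insertCoord i p.1 p.2) :=
    hG.comp (continuous_insertCoord i)
  exact this.continuousOn.integrableOn_compact (isCompact_Icc.prod (isCompact_closedBall _ _))

lemma norm_insertNth_le {n : ℕ} (i : Fin (n + 1)) {t c : ℝ} {y : Fin n → ℝ} (ht : |t| ≤ c)
    (hy : ‖y‖ ≤ c) : ‖insertCoord i t y‖ ≤ c := by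
  refine (pi_norm_le_iff_of_nonneg ((abs_nonneg t).trans ht)).2 fun j => ?_
  refine Fin.succAboveCases i ?_ (fun k => ?_) j
  · simpa using ht
  · simpa using (norm_le_pi_norm y k).trans hy

lemma integral_slice_le {n : ℕ} {G : (Fin (n + 1) → ℝ) → ℝ} (hG : Continuous G)
    (h0 : ∀ z, 0 ≤ G z) (i : Fin (n + 1)) :
    ∫ t in Icc (1 : ℝ) 2, ∫ y in closedBall (0 : Fin n → ℝ) 2, G (insertCoord i t y) ≤
      ∫ z in {z : Fin (n + 1) → ℝ | 1 ≤ ‖z‖ ∧ ‖z‖ ≤ 2}, G z := by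
  have hi := integrableOn_slice hG i
  rw [Measure.prod_restrict] at hi
  rw [← setIntegral_prod (fun p : ℝ × (Fin n → ℝ) => G (insertCoord i p.1 p.2)) hi]
  set e := MeasurableEquiv.piFinSuccAbove (fun _ : Fin (n + 1) => ℝ) i with he
  have hmp := volume_preserving_piFinSuccAbove (fun _ : Fin (n + 1) => ℝ) i
  have h1 := hmp.setIntegral_preimage_emb e.measurableEmbedding
    (fun p : ℝ × (Fin n → ℝ) => G (insertCoord i p.1 p.2))
    (Icc (1 : ℝ) 2 ×ˢ closedBall (0 : Fin n → ℝ) 2)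
  have h2 : ∀ z, insertCoord i (e z).1 (e z).2 = z := fun z => e.symm_apply_apply z
  have hAk : IsCompact {z : Fin (n + 1) → ℝ | 1 ≤ ‖z‖ ∧ ‖z‖ ≤ 2} := by
    refine (isCompact_closedBall (0 : Fin (n + 1) → ℝ) 2).of_isClosed_subset ?_ ?_
    · exact (isClosed_le continuous_const continuous_norm).inter
        (isClosed_le continuous_norm continuous_const)
    · intro z hz
      simpa using hz.2
  refine h1.symm.trans_le ?_
  simp only [← he, h2]
  refine setIntegral_mono_set (hG.continuousOn.integrableOn_compact hAk)
    (Eventually.of_forall h0) (LE.le.eventuallyLE fun z hz => ?_)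
  obtain ⟨ht, hy⟩ := hz
  rw [← h2 z]
  have hy' : ‖(e z).2‖ ≤ 2 := by simpa using hy
  have ht0 : |(e z).1| = (e z).1 := abs_of_nonneg (zero_le_one.trans ht.1)
  refine ⟨?_, norm_insertNth_le i (ht0.trans_le ht.2) hy'⟩
  have := norm_le_pi_norm (insertCoord i (e z).1 (e z).2) i
  rw [insertCoord_same, Real.norm_eq_abs, ht0] at this
  exact ht.1.trans this

/-- The inclusion of a coordinate hyperplane. -/
def hyperplaneIncl {n : ℕ} (i : Fin (n + 1)) : (Fin n → ℝ) →L[ℝ] (Fin (n + 1) → ℝ) :=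
  LinearMap.mkContinuous
    { toFun := fun y => insertCoord i 0 y
      map_add' := fun y z => by
        ext j; refine Fin.succAboveCases i ?_ (fun k => ?_) j <;> simp
      map_smul' := fun c y => by
        ext j; refine Fin.succAboveCases i ?_ (fun k => ?_) j <;> simp } 1
    fun y => by
      rw [one_mul]
      exact norm_insertNth_le i (by simp) le_rfl

lemma norm_hyperplaneIncl_le {n : ℕ} (i : Fin (n + 1)) : ‖hyperplaneIncl i‖ ≤ 1 :=
  LinearMap.mkContinuous_norm_le _ zero_le_one _

lemma insertNth_eq_add_hyperplaneIncl {n : ℕ} (i : Fin (n + 1)) (t : ℝ) (y : Fin n → ℝ) :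
    insertCoord i t y = insertCoord i t 0 + hyperplaneIncl i y := by
  ext j
  refine Fin.succAboveCases i ?_ (fun k => ?_) j <;> simp [hyperplaneIncl]

/-- Oscillation bound on one face of a cube. -/
lemma exists_face_osc_le (n : ℕ) : ∃ C : ℝ, 0 < C ∧
    ∀ (W : (Fin (n + 1) → ℝ) → ℝ) (μ : ℝ), ContDiff ℝ 1 W → 0 < μ →
      ∫ z in {z : Fin (n + 1) → ℝ | 1 ≤ ‖z‖ ∧ ‖z‖ ≤ 2}, ‖fderiv ℝ W z‖ ^ (n + 1) ≤ μ ^ (n + 1) →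
      ∃ t ∈ Icc (1 : ℝ) 2, ∀ (i : Fin (n + 1)) (z w : Fin (n + 1) → ℝ), z i = w i → |z i| = t →
        ‖z‖ ≤ t → ‖w‖ ≤ t → |W z - W w| ≤ C * μ := by
  obtain ⟨C, hC, hM⟩ := exists_abs_sub_le_of_energy n
  refine ⟨C * (2 * (n + 1)), by positivity, fun W μ hW hμ hE => ?_⟩
  set Q := closedBall (0 : Fin n → ℝ) 2 with hQ
  set F : (Fin (n + 1) → ℝ) → ℝ := fun z => ‖fderiv ℝ W z‖ ^ (n + 1) with hF
  have hFc : Continuous F := (hW.continuous_fderiv one_ne_zero).norm.pow _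
  have hF0 : ∀ z, 0 ≤ F z := fun z => by positivity
  set A := {z : Fin (n + 1) → ℝ | 1 ≤ ‖z‖ ∧ ‖z‖ ≤ 2} with hA
  set G : ℤˣ → (Fin (n + 1) → ℝ) → ℝ := fun σ z => F (((σ : ℤ) : ℝ) • z) with hG
  have hGc : ∀ σ, Continuous (G σ) := fun σ => hFc.comp (continuous_const_smul _)
  have hG0 : ∀ σ z, 0 ≤ G σ z := fun σ z => hF0 _
  have hGE : ∀ σ, ∫ z in A, G σ z ≤ μ ^ (n + 1) := by
    intro σ
    rcases Int.units_eq_one_or σ with rfl | rfl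
    · simpa [hG] using hE
    · have hpre : (fun z : Fin (n + 1) → ℝ => -z) ⁻¹' A = A := by ext z; simp [hA]
      have := (Measure.measurePreserving_neg
        (volume : Measure (Fin (n + 1) → ℝ))).setIntegral_preimage_emb
        (Homeomorph.neg (Fin (n + 1) → ℝ)).measurableEmbedding F A
      have h2 : ∫ z in A, F (-z) = ∫ z in A, F z := by
        rw [← this]
        exact congrArg (fun s => ∫ z in s, F (-z)) hpre.symm
      simpa [hG] using h2.trans_le hE
  set H : Fin (n + 1) × ℤˣ → ℝ → ℝ := fun q t => ∫ y in Q, G q.2 (insertCoord q.1 t y) with hH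
  have hH0 : ∀ q t, 0 ≤ H q t := fun q t => integral_nonneg fun y => hG0 _ _
  have hHi : ∀ q, IntegrableOn (H q) (Icc 1 2) := fun q =>
    (integrableOn_slice (hGc q.2) q.1).integral_prod_left
  have hsum : ∫ t in Icc (1 : ℝ) 2, ∑ q, H q t ≤ 2 * (n + 1) * μ ^ (n + 1) := by
    rw [integral_finsetSum _ fun q _ => hHi q]
    have hq : ∀ q, ∫ t in Icc (1 : ℝ) 2, H q t ≤ μ ^ (n + 1) := fun q =>
      (integral_slice_le (hGc q.2) (hG0 q.2) q.1).trans (hGE q.2)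
    refine (Finset.sum_le_sum fun q _ => hq q).trans_eq ?_
    rw [Finset.sum_const, Finset.card_univ, Fintype.card_prod, Fintype.card_fin,
      Fintype.card_units_int, nsmul_eq_mul]
    push_cast
    ring
  obtain ⟨t, ht, hav⟩ := exists_le_setAverage (μ := volume) (s := Icc (1 : ℝ) 2)
    (f := fun t => ∑ q, H q t) (by simp) (by simp) (integrable_finsetSum _ fun q _ => hHi q)
  have hav' : ∑ q, H q t ≤ 2 * (n + 1) * μ ^ (n + 1) := by
    refine (hav.trans_eq ?_).trans hsum
    rw [setAverage_eq]
    norm_num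
  have ht0 : 0 < t := zero_lt_one.trans_le ht.1
  have hface : ∀ (q : Fin (n + 1) × ℤˣ), ∀ y ∈ Q, ∀ y' ∈ Q,
      |W (((q.2 : ℤ) : ℝ) • insertCoord q.1 t y) - W (((q.2 : ℤ) : ℝ) • insertCoord q.1 t y')| ≤
        C * (2 * (n + 1) * μ) := by
    rintro ⟨i, σ⟩ y hy y' hy'
    set ς : ℝ := ((σ : ℤ) : ℝ) with hς
    have hς1 : |ς| = 1 := by
      rcases Int.units_eq_one_or σ with h | h <;> simp [hς, h]
    have hHle : H (i, σ) t ≤ 2 * (n + 1) * μ ^ (n + 1) :=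
      (Finset.single_le_sum (f := fun q => H q t) (fun q _ => hH0 q t)
        (Finset.mem_univ (i, σ))).trans hav'
    have hfun : ∀ y : Fin n → ℝ, HasFDerivAt (fun y : Fin n → ℝ => W (ς • insertCoord i t y))
        ((fderiv ℝ W (ς • insertCoord i t y)).comp (ς • hyperplaneIncl i)) y := by
      intro y
      have h1 : HasFDerivAt (fun y : Fin n → ℝ => ς • insertCoord i t y)
          (ς • hyperplaneIncl i) y := by
        have e : (fun y => ς • insertCoord i t y) =
            fun y => ς • (insertCoord i t 0 + hyperplaneIncl i y) :=
          funext fun y => by rw [← insertNth_eq_add_hyperplaneIncl i t y]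
        rw [e]
        exact ((hyperplaneIncl i).hasFDerivAt.const_add _).const_smul ς
      exact ((hW.differentiable one_ne_zero) _).hasFDerivAt.comp y h1
    have hWc : ContDiff ℝ 1 fun y : Fin n → ℝ => W (ς • insertCoord i t y) := by
      have e : (fun y => W (ς • insertCoord i t y)) =
          fun y => W (ς • (insertCoord i t 0 + hyperplaneIncl i y)) :=
        funext fun y => by rw [← insertNth_eq_add_hyperplaneIncl i t y]
      rw [e]
      exact hW.comp ((contDiff_const.add (hyperplaneIncl i).contDiff).const_smul ς)
    refine hM (fun y => W (ς • insertCoord i t y)) (2 * (n + 1) * μ) hWc (by positivity) ?_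
      y hy y' hy'
    have hle : ∀ z, ‖fderiv ℝ (fun y : Fin n → ℝ => W (ς • insertCoord i t y)) z‖ ^ (n + 1) ≤
        G σ (insertCoord i t z) := by
      intro z
      refine pow_le_pow_left₀ (norm_nonneg _) ?_ _
      rw [(hfun z).fderiv]
      refine (ContinuousLinearMap.opNorm_comp_le _ _).trans ?_
      rw [norm_smul, Real.norm_eq_abs, hς1, one_mul]
      exact mul_le_of_le_one_right (norm_nonneg _) (norm_hyperplaneIncl_le i)
    have hQk : IsCompact Q := isCompact_closedBall _ _
    have h1 : ∫ z in Q, ‖fderiv ℝ (fun y : Fin n → ℝ => W (ς • insertCoord i t y)) z‖ ^ (n + 1) ≤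
        H (i, σ) t := by
      refine integral_mono ?_ ?_ hle
      · exact ((hWc.continuous_fderiv one_ne_zero).norm.pow _).continuousOn.integrableOn_compact hQk
      · exact ((hGc σ).comp
          ((continuous_insertCoord i).comp (Continuous.prodMk_right t))).continuousOn.integrableOn_compact hQk
    refine h1.trans (hHle.trans ?_)
    rw [mul_pow]
    refine mul_le_mul_of_nonneg_right ?_ (by positivity)
    have hn : (0 : ℝ) ≤ n := n.cast_nonneg
    exact le_self_pow₀ (by linarith) (by omega)
  refine ⟨t, ht, fun i z w hzw hzt hz hw => ?_⟩
  obtain ⟨σ, hσ⟩ : ∃ σ : ℤˣ, z i = ((σ : ℤ) : ℝ) * t := by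
    rcases abs_eq ht0.le |>.1 hzt with h | h
    · exact ⟨1, by simp [h]⟩
    · exact ⟨-1, by simp [h]⟩
  set ς : ℝ := ((σ : ℤ) : ℝ) with hς
  have hς1 : ς * ς = 1 := by
    rcases Int.units_eq_one_or σ with h | h <;> simp [hς, h]
  have hςn : ‖ς‖ = 1 := by
    rcases Int.units_eq_one_or σ with h | h <;> simp [hς, h]
  have hrep : ∀ v : Fin (n + 1) → ℝ, v i = ς * t →
      v = ς • insertCoord i t (ς • i.removeNth v) := by
    intro v hv
    ext j
    refine Fin.succAboveCases i ?_ (fun k => ?_) j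
    · simp [hv]
    · simp [Fin.removeNth, ← mul_assoc, hς1]
  have hmem : ∀ v : Fin (n + 1) → ℝ, ‖v‖ ≤ t → ς • i.removeNth v ∈ Q := by
    intro v hv
    rw [hQ, mem_closedBall_zero_iff, norm_smul, hςn, one_mul]
    refine (pi_norm_le_iff_of_nonneg zero_le_two).2 fun k => ?_
    exact ((norm_le_pi_norm v (i.succAbove k)).trans hv).trans ht.2
  have := hface (i, σ) _ (hmem z hz) _ (hmem w hw)
  rw [← hrep z hσ, ← hrep w (hzw ▸ hσ)] at this
  linarith

/-- Oscillation bound on the boundary of a suitable cube. -/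
lemma exists_cube_osc_le {n : ℕ} (hn : 1 ≤ n) : ∃ C : ℝ, 0 < C ∧
    ∀ (W : (Fin (n + 1) → ℝ) → ℝ) (μ : ℝ), ContDiff ℝ 1 W → 0 < μ →
      ∫ z in {z : Fin (n + 1) → ℝ | 1 ≤ ‖z‖ ∧ ‖z‖ ≤ 2}, ‖fderiv ℝ W z‖ ^ (n + 1) ≤ μ ^ (n + 1) →
      ∃ t ∈ Icc (1 : ℝ) 2, ∀ x y : Fin (n + 1) → ℝ, ‖x‖ = t → ‖y‖ = t → |W x - W y| ≤ C * μ := by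
  obtain ⟨C, hC, hM⟩ := exists_face_osc_le n
  refine ⟨3 * C, by positivity, fun W μ hW hμ hE => ?_⟩
  obtain ⟨t, ht, hface⟩ := hM W μ hW hμ hE
  have ht0 : 0 < t := zero_lt_one.trans_le ht.1
  have hcoord : ∀ x : Fin (n + 1) → ℝ, ‖x‖ = t → ∃ i, |x i| = t := by
    intro x hx
    by_contra! h
    refine ((pi_norm_lt_iff ht0).2 fun i => ?_).ne hx
    exact lt_of_le_of_ne ((norm_le_pi_norm x i).trans hx.le) (h i)
  have hne : ∀ (x y : Fin (n + 1) → ℝ) (i j), i ≠ j → ‖x‖ ≤ t → ‖y‖ ≤ t → |x i| = t → |y j| = t →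
      |W x - W y| ≤ 2 * (C * μ) := by
    intro x y i j hij hx hy hxi hyj
    set w : Fin (n + 1) → ℝ := Function.update y i (x i) with hw
    have hwn : ‖w‖ ≤ t := by
      refine (pi_norm_le_iff_of_nonneg ht0.le).2 fun k => ?_
      by_cases hk : k = i
      · subst hk; simp [hw, hxi]
      · simpa [hw, hk] using (norm_le_pi_norm y k).trans hy
    have h1 := hface i x w (by simp [hw]) hxi hx hwn
    have h2 := hface j y w (by simp [hw, hij.symm]) hyj hy hwn
    rw [abs_le] at *
    constructor <;> linarith [h1.1, h1.2, h2.1, h2.2]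
  refine ⟨t, ht, fun x y hx hy => ?_⟩
  obtain ⟨i, hi⟩ := hcoord x hx
  obtain ⟨j, hj⟩ := hcoord y hy
  have : Nontrivial (Fin (n + 1)) := Fin.nontrivial_iff_two_le.2 (by omega)
  obtain ⟨k, hk⟩ := exists_ne j
  set w : Fin (n + 1) → ℝ := Function.update x k t with hw
  have hwn : ‖w‖ ≤ t := by
    refine (pi_norm_le_iff_of_nonneg ht0.le).2 fun l => ?_
    by_cases hl : l = k
    · subst hl; simp [hw, abs_of_pos ht0]
    · simpa [hw, hl] using (norm_le_pi_norm x l).trans hx.le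
  have hwk : |w k| = t := by simp [hw, abs_of_pos ht0]
  have h2 := hne w y k j hk hwn hy.le hwk hj
  have hCμ : 0 < C * μ := by positivity
  by_cases hik : i = k
  · have h1 := hne x y i j (by rwa [hik]) hx.le hy.le hi hj
    linarith
  · have h1 := hface i x w (by simp [hw, hik]) hi hx.le hwn
    have := abs_sub_le (W x) (W w) (W y)
    linarith

/-- The sup norm of the coordinates. -/
def cubeNorm (x : 𝔼) : ℝ := ‖(WithLp.ofLp x : Fin d → ℝ)‖

lemma continuous_cubeNorm : Continuous (cubeNorm : 𝔼 → ℝ) :=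
  (PiLp.continuous_ofLp 2 _).norm

lemma cubeNorm_le_norm (x : 𝔼) : cubeNorm x ≤ ‖x‖ :=
  (pi_norm_le_iff_of_nonneg (norm_nonneg x)).2 fun i => PiLp.norm_apply_le x i

lemma norm_le_mul_cubeNorm (x : 𝔼) : ‖x‖ ≤ d * cubeNorm x := by
  have hN : 0 ≤ cubeNorm x := norm_nonneg _
  refine le_of_sq_le_sq ?_ (by positivity)
  rw [EuclideanSpace.norm_sq_eq]
  calc ∑ i, ‖x i‖ ^ 2 ≤ ∑ _i : Fin d, cubeNorm x ^ 2 :=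
        Finset.sum_le_sum fun i _ =>
          pow_le_pow_left₀ (norm_nonneg _) (norm_le_pi_norm (WithLp.ofLp x) i) 2
    _ = d * cubeNorm x ^ 2 := by simp
    _ ≤ (d : ℝ) ^ 2 * cubeNorm x ^ 2 := by
        refine mul_le_mul_of_nonneg_right ?_ (by positivity)
        exact_mod_cast Nat.le_self_pow two_ne_zero d
    _ = (d * cubeNorm x) ^ 2 := (mul_pow _ _ _).symm

lemma cubeNorm_smul (c : ℝ) (x : 𝔼) : cubeNorm (c • x) = |c| * cubeNorm x := by
  simp [cubeNorm, norm_smul]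

/-- The conformal energy on a cubical shell is controlled by that on an exterior domain. -/
lemma exists_integral_shell_le (d : ℕ) : ∃ κ : ℝ, 0 < κ ∧
    ∀ (V : EuclideanSpace ℝ (Fin d) → ℝ) (R ρ : ℝ), ContDiff ℝ 1 V → 0 < R → ρ < R →
      (Integrable fun x => ‖fderiv ℝ V x‖ ^ d) →
      ∫ z in {z : Fin d → ℝ | 1 ≤ ‖z‖ ∧ ‖z‖ ≤ 2},
        ‖fderiv ℝ (fun z : Fin d → ℝ => V (R • WithLp.toLp 2 z)) z‖ ^ d ≤
      κ * ∫ x in {x : EuclideanSpace ℝ (Fin d) | ρ < ‖x‖}, ‖fderiv ℝ V x‖ ^ d := by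
  set L : (Fin d → ℝ) →L[ℝ] EuclideanSpace ℝ (Fin d) :=
    (PiLp.continuousLinearEquiv 2 ℝ fun _ : Fin d => ℝ).symm.toContinuousLinearMap with hL
  refine ⟨(‖L‖ + 1) ^ d, by positivity, fun V R ρ hV hR hρ hint => ?_⟩
  set F : EuclideanSpace ℝ (Fin d) → ℝ := fun x => ‖fderiv ℝ V x‖ ^ d with hF
  have hFc : Continuous F := (hV.continuous_fderiv one_ne_zero).norm.pow _
  have hF0 : ∀ x, 0 ≤ F x := fun x => by positivity
  set A := {z : Fin d → ℝ | 1 ≤ ‖z‖ ∧ ‖z‖ ≤ 2} with hA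
  set A' := {x : EuclideanSpace ℝ (Fin d) | 1 ≤ cubeNorm x ∧ cubeNorm x ≤ 2} with hA'
  have hAk : IsCompact A := by
    refine (isCompact_closedBall (0 : Fin d → ℝ) 2).of_isClosed_subset ?_ ?_
    · exact (isClosed_le continuous_const continuous_norm).inter
        (isClosed_le continuous_norm continuous_const)
    · intro z hz
      simpa using hz.2
  have hWd : ∀ z, HasFDerivAt (fun z : Fin d → ℝ => V (R • WithLp.toLp 2 z))
      ((fderiv ℝ V (R • L z)).comp (R • L)) z := fun z =>
    ((hV.differentiable one_ne_zero) (R • L z)).hasFDerivAt.comp z (L.hasFDerivAt.const_smul R)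
  have hle : ∀ z, ‖fderiv ℝ (fun z : Fin d → ℝ => V (R • WithLp.toLp 2 z)) z‖ ^ d ≤
      (‖L‖ + 1) ^ d * (R ^ d * F (R • L z)) := by
    intro z
    rw [(hWd z).fderiv, hF, ← mul_pow, ← mul_pow]
    refine pow_le_pow_left₀ (norm_nonneg _) ?_ _
    refine (ContinuousLinearMap.opNorm_comp_le _ _).trans ?_
    rw [norm_smul, Real.norm_of_nonneg hR.le]
    have h1 : 0 ≤ R * ‖fderiv ℝ V (R • L z)‖ := by positivity
    nlinarith
  have hc1 : Continuous fun z : Fin d → ℝ => F (R • L z) := hFc.comp (L.continuous.const_smul R)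
  have hWc : ContDiff ℝ 1 fun z : Fin d → ℝ => V (R • WithLp.toLp 2 z) :=
    hV.comp (L.contDiff.const_smul R)
  have h1 : ∫ z in A, ‖fderiv ℝ (fun z : Fin d → ℝ => V (R • WithLp.toLp 2 z)) z‖ ^ d ≤
      ∫ z in A, (‖L‖ + 1) ^ d * (R ^ d * F (R • L z)) := by
    refine setIntegral_mono ?_ ?_ hle
    · exact ((hWc.continuous_fderiv one_ne_zero).norm.pow _).continuousOn.integrableOn_compact hAk
    · exact (hc1.const_mul _ |>.const_mul _).continuousOn.integrableOn_compact hAk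
  have h2 : ∫ z in A, F (R • L z) = ∫ x in A', F (R • x) :=
    ((EuclideanSpace.volume_preserving_symm_measurableEquiv_toLp
      (Fin d)).symm).setIntegral_preimage_emb
      (MeasurableEquiv.toLp 2 (Fin d → ℝ)).measurableEmbedding (fun x => F (R • x)) A'
  have h3 := Measure.setIntegral_comp_smul_of_pos volume F A' hR
  rw [finrank_euclideanSpace_fin, smul_eq_mul] at h3
  refine h1.trans ?_
  rw [integral_const_mul, integral_const_mul, h2, h3, mul_inv_cancel_left₀ (by positivity)]
  refine mul_le_mul_of_nonneg_left ?_ (by positivity)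
  refine setIntegral_mono_set hint.integrableOn (Eventually.of_forall hF0)
    (LE.le.eventuallyLE ?_)
  rintro _ ⟨x, hx, rfl⟩
  change ρ < ‖R • x‖
  rw [norm_smul, Real.norm_of_nonneg hR.le]
  have := hx.1.trans (cubeNorm_le_norm x)
  nlinarith

section Critical

variable {R₀ r : ℝ} {u : EuclideanSpace ℝ (Fin d) → ℝ}

lemma IsPHarmonic.exists_cube_ratio_le (hd : 2 ≤ d) (hR₀ : 0 < R₀)
    (hu : IsPHarmonic (d : ℝ) {x : 𝔼 | R₀ < ‖x‖} u) (hpos : ∀ x : 𝔼, R₀ < ‖x‖ → 0 < u x)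
    {ε : ℝ} (hε : 0 < ε) :
    ∃ S₀, 0 < S₀ ∧ ∀ R > S₀, ∃ s ∈ Icc R (2 * R), ∀ x y : 𝔼, cubeNorm x = s → cubeNorm y = s →
      u x ≤ (1 + ε) * u y := by
  obtain ⟨V, hV, hVu, hVi⟩ := hu.exists_log_extension hd hR₀ hpos
  obtain ⟨κ, hκ, hE⟩ := exists_integral_shell_le d
  obtain ⟨n, rfl⟩ : ∃ n, d = n + 1 := ⟨d - 1, by omega⟩
  obtain ⟨C, hC, hosc⟩ := exists_cube_osc_le (n := n) (by omega)
  have hlog : 0 < Real.log (1 + ε) := Real.log_pos (by linarith)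
  set μ := Real.log (1 + ε) / C with hμ
  have hμ0 : 0 < μ := by positivity
  obtain ⟨S, hS⟩ := exists_setIntegral_exterior_le hVi (ε := μ ^ (n + 1) / κ) (by positivity)
  refine ⟨max S (R₀ + 2), lt_max_of_lt_right (by positivity), fun R hR => ?_⟩
  have hSR : S < R := (le_max_left _ _).trans_lt hR
  have hR₀R : R₀ + 2 < R := (le_max_right _ _).trans_lt hR
  have hR0 : 0 < R := by linarith
  obtain ⟨t, ht, H⟩ := hosc (fun z => V (R • WithLp.toLp 2 z)) μ
    (hV.comp ((PiLp.contDiff_toLp (p := 2)).const_smul R)) hμ0 (by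
      refine (hE V R S hV hR0 hSR hVi).trans ?_
      have := hS S le_rfl
      rw [le_div_iff₀ hκ] at this
      linarith)
  refine ⟨R * t, ⟨by nlinarith [ht.1], by nlinarith [ht.2]⟩, fun x y hx hy => ?_⟩
  have hresc : ∀ x : EuclideanSpace ℝ (Fin (n + 1)), cubeNorm x = R * t →
      ‖WithLp.ofLp (R⁻¹ • x)‖ = t := by
    intro x hx
    have := cubeNorm_smul R⁻¹ x
    rw [hx, abs_of_pos (inv_pos.2 hR0), inv_mul_cancel_left₀ hR0.ne'] at this
    exact this
  have hbig : ∀ x : EuclideanSpace ℝ (Fin (n + 1)), cubeNorm x = R * t → R₀ + 2 ≤ ‖x‖ := by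
    intro x hx
    have := cubeNorm_le_norm x
    nlinarith [ht.1]
  have h1 := H _ _ (hresc x hx) (hresc y hy)
  simp only [WithLp.toLp_ofLp, smul_inv_smul₀ hR0.ne'] at h1
  rw [hVu x (hbig x hx), hVu y (hbig y hy), hμ, mul_div_cancel₀ _ hC.ne'] at h1
  have hux := hpos x (by linarith [hbig x hx])
  have huy := hpos y (by linarith [hbig y hy])
  rw [← Real.log_le_log_iff hux (by positivity), Real.log_mul (by positivity) huy.ne']
  linarith [(abs_le.1 h1).2]

lemma IsPHarmonic.exists_cube_le (hd : 2 ≤ d) (hR₀ : 0 < R₀) (hr : R₀ < r)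
    (hu : IsPHarmonic (d : ℝ) {x : 𝔼 | R₀ < ‖x‖} u) (hpos : ∀ x : 𝔼, R₀ < ‖x‖ → 0 < u x)
    {a : ℝ} (ha : 0 ≤ a)
    (hac : ∀ c > a, ∀ S, ∃ x, S < ‖x‖ ∧ u x < c * radialSol d r x) {ε : ℝ} (hε : 0 < ε) (S : ℝ) :
    ∃ s > S, ∀ x : 𝔼, cubeNorm x = s → r ≤ ‖x‖ → u x ≤ (a + ε) * radialSol d r x := by
  have hr0 : 0 < r := hR₀.trans hr
  have hd0 : (0 : ℝ) < d := by exact_mod_cast (by omega : 0 < d)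
  have hd2 : (2 : ℝ) ≤ d := by exact_mod_cast hd
  have hT : ∀ x : 𝔼, radialSol d r x = Real.log ‖x‖ - Real.log r := fun x => by
    simp [radialSol, radialGauge]
  obtain ⟨S₀, hS₀, hratio⟩ := hu.exists_cube_ratio_le hd hR₀ hpos
    (ε := ε / 4 / (a + ε / 4)) (by positivity)
  set L := Real.log (2 * d) with hL
  obtain ⟨t₀, ht₀⟩ := radialSol_eventually_lt (d := d) hd d r ((a + ε / 2) * L / (ε / 2))
  obtain ⟨z, hz, huz⟩ := hac (a + ε / 4) (by linarith)
    (2 * d * max (max S S₀) (max t₀ r))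
  set R := cubeNorm z / 2 with hR
  have hzR : ‖z‖ ≤ 2 * d * R := by
    have := norm_le_mul_cubeNorm z
    rw [hR]; linarith
  have hbig : max (max S S₀) (max t₀ r) < R :=
    lt_of_mul_lt_mul_left (hz.trans_le hzR) (by positivity)
  simp only [max_lt_iff] at hbig
  obtain ⟨⟨hSR, hS₀R⟩, htR, hrR⟩ := hbig
  obtain ⟨s, ⟨hs1, hs2⟩, hs⟩ := hratio R hS₀R
  have hsz : s ≤ cubeNorm z := by rw [hR] at hs2; linarith
  refine ⟨s, hSR.trans_le hs1, fun x hx _ => ?_⟩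
  obtain ⟨y, hy, huy⟩ : ∃ y : 𝔼, cubeNorm y = s ∧ u y < (a + ε / 4) * radialSol d r z := by
    by_contra! h
    exact huz.not_ge (hu.le_of_le_level hd le_rfl hR₀ hr continuous_cubeNorm cubeNorm_le_norm
      (hrR.le.trans hs1) (fun w hw => (hpos w (hr.trans_le hw)).le) h hsz)
  have hsx : s ≤ ‖x‖ := hx ▸ cubeNorm_le_norm x
  have hx0 : 0 < ‖x‖ := by linarith
  have hz0 : 0 < ‖z‖ := by
    have := cubeNorm_le_norm z
    linarith
  have hTz : radialSol d r z ≤ L + radialSol d r x := by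
    have : Real.log ‖z‖ ≤ L + Real.log ‖x‖ := by
      rw [hL, ← Real.log_mul (by positivity) hx0.ne']
      refine Real.log_le_log hz0 (hzR.trans ?_)
      exact mul_le_mul_of_nonneg_left (hs1.trans hsx) (by positivity)
    rw [hT, hT]
    linarith
  have hTx := ht₀ x (htR.le.trans (hs1.trans hsx))
  rw [div_lt_iff₀ (half_pos hε)] at hTx
  have hb : 0 < a + ε / 4 := by positivity
  calc u x ≤ (1 + ε / 4 / (a + ε / 4)) * u y := hs x y hx hy
    _ ≤ (1 + ε / 4 / (a + ε / 4)) * ((a + ε / 4) * radialSol d r z) :=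
        mul_le_mul_of_nonneg_left huy.le (by positivity)
    _ = (a + ε / 2) * radialSol d r z := by field_simp; ring
    _ ≤ (a + ε / 2) * (L + radialSol d r x) := mul_le_mul_of_nonneg_left hTz (by positivity)
    _ ≤ (a + ε) * radialSol d r x := by linarith

lemma IsPHarmonic.exists_cube_osc_le (hd : 2 ≤ d) (hR₀ : 0 < R₀)
    (hu : IsPHarmonic (d : ℝ) {x : 𝔼 | R₀ < ‖x‖} u) (hpos : ∀ x : 𝔼, R₀ < ‖x‖ → 0 < u x) {M : ℝ}
    (hM : ∀ x, r ≤ ‖x‖ → u x ≤ M) {ε : ℝ} (hε : 0 < ε) (S : ℝ) :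
    ∃ s > S, ∃ c, ∀ x : 𝔼, cubeNorm x = s → r ≤ ‖x‖ → c ≤ u x ∧ u x ≤ c + ε := by
  have hM0 : 0 ≤ M := by
    obtain ⟨x, hx⟩ := exists_euclidean_norm_eq hd (t := max r (R₀ + 1))
      (le_max_of_le_right (by positivity))
    refine (hpos x ?_).le.trans (hM x ?_) <;> rw [hx]
    · exact lt_max_of_lt_right (by linarith)
    · exact le_max_left _ _
  set ε' := ε / (2 * (M + 1)) with hε'
  have hε'0 : 0 < ε' := by positivity
  have hε'M : ε' * M ≤ ε / 2 := by
    rw [hε', div_mul_eq_mul_div, div_le_div_iff₀ (by positivity) two_pos]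
    nlinarith
  obtain ⟨S₀, hS₀, hratio⟩ := hu.exists_cube_ratio_le hd hR₀ hpos hε'0
  obtain ⟨s, ⟨hs1, -⟩, hs⟩ := hratio (max (max S S₀) r + 1)
    (by linarith [(le_max_right S S₀).trans (le_max_left (max S S₀) r)])
  have hSs : S < s := by linarith [(le_max_left S S₀).trans (le_max_left (max S S₀) r)]
  by_cases hne : ∃ y : 𝔼, cubeNorm y = s
  · obtain ⟨y, hy⟩ := hne
    have hry : r ≤ ‖y‖ := by
      have := cubeNorm_le_norm y
      linarith [le_max_right (max S S₀) r]
    refine ⟨s, hSs, u y - ε / 2, fun x hx hrx => ?_⟩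
    have h1 := hs x y hx hy
    have h2 := hs y x hy hx
    have h3 := mul_le_mul_of_nonneg_left (hM x hrx) hε'0.le
    have h4 := mul_le_mul_of_nonneg_left (hM y hry) hε'0.le
    constructor <;> linarith
  · exact ⟨s, hSs, 0, fun x hx => (hne ⟨x, hx⟩).elim⟩

end Critical

end PositivePHarmonic

theorem stmt16 (d : ℕ) (hd : 2 ≤ d) (p : ℝ) (hpd : (d : ℝ) ≤ p) (R₀ : ℝ) (hR₀ : 0 < R₀)
    (u : EuclideanSpace ℝ (Fin d) → ℝ)
    (hu : IsPosWeakSol p (fun _ => 0) {x : EuclideanSpace ℝ (Fin d) | R₀ < ‖x‖} u) :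
    Xor'
      (∃ c : ℝ, 0 < c ∧
        Tendsto u (Bornology.cobounded (EuclideanSpace ℝ (Fin d))) (𝓝 c))
      (∃ c : ℝ, 0 < c ∧
        ((d : ℝ) < p →
          Tendsto (fun x : EuclideanSpace ℝ (Fin d) => u x / ‖x‖ ^ ((p - d) / (p - 1)))
            (Bornology.cobounded (EuclideanSpace ℝ (Fin d))) (𝓝 c)) ∧
        (p = d →
          Tendsto (fun x : EuclideanSpace ℝ (Fin d) => u x / Real.log ‖x‖)
            (Bornology.cobounded (EuclideanSpace ℝ (Fin d))) (𝓝 c))) := by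
  have hp2 : 2 ≤ p := le_trans (by exact_mod_cast hd) hpd
  have hpos : ∀ x : EuclideanSpace ℝ (Fin d), R₀ < ‖x‖ → 0 < u x := hu.2.1
  have hu' := hu.isPHarmonic hp2 (isOpen_exterior R₀)
  have hr : R₀ < R₀ + 1 := lt_add_one R₀
  have key : (∃ c : ℝ, 0 < c ∧
        Tendsto u (Bornology.cobounded (EuclideanSpace ℝ (Fin d))) (𝓝 c)) ∨
      ∃ c : ℝ, 0 < c ∧ Tendsto (fun x => u x / radialGauge d p ‖x‖)
        (Bornology.cobounded (EuclideanSpace ℝ (Fin d))) (𝓝 c) := by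
    rcases hpd.lt_or_eq with hlt | rfl
    · exact hu'.dichotomy hd hpd hR₀ hr hpos continuous_norm (C := 1) (fun x => le_rfl)
        (fun x => (one_mul _).ge) one_pos
        (fun a ha hau hac ε hε S =>
          hu'.exists_sphere_le hd hlt hR₀ hr hpos ha hau hac hε S)
        (fun M hM ε hε S => hu'.exists_sphere_osc_le hd hlt hR₀ hpos hM hε S)
    · exact hu'.dichotomy hd le_rfl hR₀ hr hpos continuous_cubeNorm cubeNorm_le_norm
        norm_le_mul_cubeNorm (by linarith)
        (fun a ha _ hac ε hε S => hu'.exists_cube_le hd hR₀ hr hpos ha hac hε S)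
        (fun M hM ε hε S => hu'.exists_cube_osc_le hd hR₀ hpos hM hε S)
  have hiff : ∀ c : ℝ, Tendsto (fun x => u x / radialGauge d p ‖x‖)
        (Bornology.cobounded (EuclideanSpace ℝ (Fin d))) (𝓝 c) ↔
      ((d : ℝ) < p →
          Tendsto (fun x : EuclideanSpace ℝ (Fin d) => u x / ‖x‖ ^ ((p - d) / (p - 1)))
            (Bornology.cobounded (EuclideanSpace ℝ (Fin d))) (𝓝 c)) ∧
        (p = d →
          Tendsto (fun x : EuclideanSpace ℝ (Fin d) => u x / Real.log ‖x‖)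
            (Bornology.cobounded (EuclideanSpace ℝ (Fin d))) (𝓝 c)) := by
    intro c
    rcases hpd.lt_or_eq with hlt | heq
    · simp [radialGauge, hlt, hlt.ne']
    · simp [radialGauge, heq]
  simp only [← hiff]
  refine (xor_iff_or_and_not_and _ _).2 ⟨key, ?_⟩
  rintro ⟨⟨c, -, h⟩, c', hc', h'⟩
  exact not_tendsto_and_tendsto_div_radialGauge hd hc' h h'
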